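/- For every surface Σ, every (Σ,1)-planar graph G with at least three vertices is contained in G₀^{(4)} for some multigraph G₀ embedded in Σ with no crossings where each face of G₀ is bounded by a cycle. -/

import Mathlib

/-!
Common definitions: multigraphs, combinatorial (cellular) surface embeddings,
Euler genus, framed graphs, strong products, treewidth, partitions and layerings.
-/

/-- A multigraph on vertex type `V` with edge type `E`, given by its endpoints map. -/
structure Multigraph (V E : Type) where
  ends : E → Sym2 V

namespace Multigraph

variable {V E F : Type}

/-- The simple graph underlying a multigraph. -/
def simple (G : Multigraph V E) : SimpleGraph V where
  Adj u v := u ≠ v ∧ ∃ e, G.ends e = s(u, v)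
  symm := by
    refine ⟨?_⟩
    rintro u v ⟨hne, e, he⟩
    exact ⟨hne.symm, e, he.trans Sym2.eq_swap⟩
  loopless := by refine ⟨?_⟩; rintro u ⟨hne, -⟩; exact hne rfl

/-- The simple graph on `V` whose edges are the edges of `G` lying in `S`. -/
def simpleOn (G : Multigraph V E) (S : Set E) : SimpleGraph V where
  Adj u v := u ≠ v ∧ ∃ e ∈ S, G.ends e = s(u, v)
  symm := by
    refine ⟨?_⟩
    rintro u v ⟨hne, e, heS, he⟩
    exact ⟨hne.symm, e, heS, he.trans Sym2.eq_swap⟩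
  loopless := by refine ⟨?_⟩; rintro u ⟨hne, -⟩; exact hne rfl

/-- A multigraph is simple: no loops and no parallel edges. -/
def IsSimple (G : Multigraph V E) : Prop :=
  (∀ e, ¬ (G.ends e).IsDiag) ∧ Function.Injective G.ends

/-- A set `S` of edges of `G` forms a spanning tree of `G`. -/
def IsSpanningTree (G : Multigraph V E) (S : Set E) : Prop :=
  (G.simpleOn S).IsTree ∧ (∀ e ∈ S, ¬ (G.ends e).IsDiag) ∧
    ∀ e ∈ S, ∀ e' ∈ S, G.ends e = G.ends e' → e = e'

/-- A closed walk in a multigraph, recorded as periodic sequences of vertices and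
edges: the walk visits `vtx 0, vtx 1, …, vtx (len - 1)` and returns to
`vtx len = vtx 0`, traversing the edge `edge i` between `vtx i` and `vtx (i+1)`. -/
structure CWalk (G : Multigraph V E) where
  len : ℕ
  len_pos : 0 < len
  vtx : ℕ → V
  edge : ℕ → E
  vtx_per : ∀ i, vtx (i + len) = vtx i
  edge_per : ∀ i, edge (i + len) = edge i
  compat : ∀ i, G.ends (edge i) = s(vtx i, vtx (i + 1))

namespace CWalk

variable {G : Multigraph V E}

/-- The vertex `v` lies on the closed walk `W`. -/
def HasVtx (W : G.CWalk) (v : V) : Prop := ∃ i, i < W.len ∧ W.vtx i = v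

/-- The edge `e` lies on the closed walk `W`. -/
def HasEdge (W : G.CWalk) (e : E) : Prop := ∃ i, i < W.len ∧ W.edge i = e

/-- The closed walk `W` is a cycle: it repeats no vertex and no edge. -/
def IsCycle (W : G.CWalk) : Prop :=
  (∀ i j, i < W.len → j < W.len → W.vtx i = W.vtx j → i = j) ∧
  (∀ i j, i < W.len → j < W.len → W.edge i = W.edge j → i = j)

end CWalk

/-- `p = (f, i)` is an occurrence of the edge `e` in the family `bd` of closed walks:
the walk of face `f` traverses `e` at position `i`. -/
def IsOcc {G : Multigraph V E} (bd : F → G.CWalk) (e : E) (p : F × ℕ) : Prop :=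
  p.2 < (bd p.1).len ∧ (bd p.1).edge p.2 = e

/-- `c = (f, i)` is a corner of the vertex `v`: the walk of face `f` visits `v`
at position `i`. -/
def IsCorner {G : Multigraph V E} (bd : F → G.CWalk) (v : V) (c : F × ℕ) : Prop :=
  c.2 < (bd c.1).len ∧ (bd c.1).vtx c.2 = v

/-- The corner `c` is one of the two end corners of the edge occurrence `p`. -/
def EndOf {G : Multigraph V E} (bd : F → G.CWalk) (c p : F × ℕ) : Prop :=
  c.1 = p.1 ∧ (c.2 = p.2 ∨ c.2 = (p.2 + 1) % (bd p.1).len)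

/-- Two corners of `v` are linked if they are end corners (at `v`) of the two
distinct occurrences of a common edge; this is the edge-to-edge gluing relation
around the vertex `v`. -/
def CornerLinked {G : Multigraph V E} (bd : F → G.CWalk) (v : V) (c c' : F × ℕ) : Prop :=
  IsCorner bd v c ∧ IsCorner bd v c' ∧
    ∃ (e : E) (p p' : F × ℕ), p ≠ p' ∧ IsOcc bd e p ∧ IsOcc bd e p' ∧
      EndOf bd c p ∧ EndOf bd c' p'

/-- A combinatorial (cellular) embedding of a connected multigraph `G` in a closed
surface, with face set `F`: every face is given by its closed boundary walk, every
edge of `G` is traversed exactly twice in total by the boundary walks, and the link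
of every vertex is connected (so the embedding is in a genuine surface, with no
pinch points). -/
structure Embedding (G : Multigraph V E) (F : Type) where
  boundary : F → G.CWalk
  conn : G.simple.Connected
  edge_twice : ∀ e : E, {p : F × ℕ | IsOcc boundary e p}.ncard = 2
  link_conn : ∀ (v : V) (c c' : F × ℕ), IsCorner boundary v c → IsCorner boundary v c' →
    Relation.EqvGen (CornerLinked boundary v) c c'

/-- The Euler genus `2 - (|V| - |E| + |F|)` of an embedding, via Euler's formula. -/
noncomputable def Embedding.eulerGenus {G : Multigraph V E} {F : Type}
    (_ : Embedding G F) : ℤ :=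
  2 - ((Nat.card V : ℤ) - Nat.card E + Nat.card F)

/-- The simple graph underlying the framed multigraph `G^{(d)}`: two distinct
vertices are adjacent iff they are joined by an edge of `G` or lie on a common
face of length at most `d` (in which case `G^{(d)}` has a chord between them). -/
def framedGraph {G : Multigraph V E} {F : Type} (emb : Embedding G F) (d : ℕ) :
    SimpleGraph V where
  Adj u v := u ≠ v ∧ ((∃ e, G.ends e = s(u, v)) ∨
    ∃ f, (emb.boundary f).len ≤ d ∧ (emb.boundary f).HasVtx u ∧ (emb.boundary f).HasVtx v)
  symm := by
    refine ⟨?_⟩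
    rintro u v ⟨hne, (⟨e, he⟩ | ⟨f, h1, h2, h3⟩)⟩
    · exact ⟨hne.symm, Or.inl ⟨e, he.trans Sym2.eq_swap⟩⟩
    · exact ⟨hne.symm, Or.inr ⟨f, h1, h3, h2⟩⟩
  loopless := by refine ⟨?_⟩; rintro u ⟨hne, -⟩; exact hne rfl

end Multigraph

namespace SimpleGraph

/-- `G` is contained in `X`: `G` is isomorphic to a subgraph of `X`. -/
def IsContainedIn {α β : Type} (G : SimpleGraph α) (X : SimpleGraph β) : Prop :=
  ∃ f : G →g X, Function.Injective f

/-- The strong product of two simple graphs. -/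
def strongProd {α β : Type} (G : SimpleGraph α) (H : SimpleGraph β) :
    SimpleGraph (α × β) where
  Adj x y := x ≠ y ∧ (x.1 = y.1 ∨ G.Adj x.1 y.1) ∧ (x.2 = y.2 ∨ H.Adj x.2 y.2)
  symm := by
    refine ⟨?_⟩
    rintro x y ⟨hne, h1, h2⟩
    exact ⟨hne.symm, h1.imp Eq.symm (fun h => G.adj_symm h), h2.imp Eq.symm (fun h => H.adj_symm h)⟩
  loopless := by refine ⟨?_⟩; rintro x ⟨hne, -⟩; exact hne rfl

end SimpleGraph

/-- `G` has treewidth at most `k`: it has a tree-decomposition with all bags of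
size at most `k + 1`. -/
def TreewidthLE {α : Type} (G : SimpleGraph α) (k : ℕ) : Prop :=
  ∃ (ι : Type) (T : SimpleGraph ι) (B : ι → Set α),
    T.IsTree ∧
    (∀ v, ∃ i, v ∈ B i) ∧
    (∀ u v, G.Adj u v → ∃ i, u ∈ B i ∧ v ∈ B i) ∧
    (∀ v, (T.induce {i | v ∈ B i}).Connected) ∧
    ∀ i, (B i).encard ≤ (k : ℕ∞) + 1

/-- `G` has Euler genus at most `g`: `G` is (isomorphic to) a subgraph of a
multigraph having a combinatorial embedding of Euler genus at most `g`. -/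
def HasEulerGenusLE {α : Type} (G : SimpleGraph α) (g : ℕ) : Prop :=
  ∃ (V' E' F' : Type), Finite V' ∧ Finite E' ∧ Finite F' ∧
    ∃ (M : Multigraph V' E') (emb : M.Embedding F'),
      emb.eulerGenus ≤ (g : ℤ) ∧ G.IsContainedIn M.simple

/-- A planar graph: a graph of Euler genus `0`. -/
def IsPlanar {α : Type} (G : SimpleGraph α) : Prop := HasEulerGenusLE G 0

/-- An apex graph: deleting some vertex leaves a planar graph. -/
def IsApex {α : Type} (G : SimpleGraph α) : Prop :=
  ∃ v : α, IsPlanar (G.induce {w | w ≠ v})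

/-- `A` indexes a partition of the vertices of `G` into nonempty parts `A x`, and the
quotient of `G` by this partition is (isomorphic to) `H`, via the indexing: this is an
`H`-partition of `G`. -/
def IsHPartition {α W : Type} (G : SimpleGraph α) (H : SimpleGraph W) (A : W → Set α) : Prop :=
  (∀ x, (A x).Nonempty) ∧ (∀ v, ∃! x, v ∈ A x) ∧
    ∀ x y, x ≠ y → (H.Adj x y ↔ ∃ u ∈ A x, ∃ v ∈ A y, G.Adj u v)

/-- `(L 0, L 1, …)` is a layering of `G`: an ordered partition of the vertices such
that every edge joins vertices in the same or in consecutive layers. -/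
def IsLayering {α : Type} (G : SimpleGraph α) (L : ℕ → Set α) : Prop :=
  (∀ v, ∃! j, v ∈ L j) ∧
    ∀ u v, G.Adj u v → ∀ i j, u ∈ L i → v ∈ L j → i ≤ j + 1 ∧ j ≤ i + 1

/-- `b` lies on every walk from `a` to `c` in `T` (for a tree: `b` is on the unique
`a`–`c` path). -/
def BtwIn {α : Type} (T : SimpleGraph α) (a b c : α) : Prop :=
  ∀ p : T.Walk a c, b ∈ p.support

/-- `Q` is the vertex set of a vertical path in the tree `T` rooted at `r` with upper
end `w` and lower end `u`: `w` lies on the path from `r` to `u`, and `Q` is the set of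
vertices of the `w`–`u` path. -/
def IsVerticalPathBtw {α : Type} (T : SimpleGraph α) (r : α) (Q : Set α) (w u : α) : Prop :=
  BtwIn T r w u ∧ Q = {x | BtwIn T w x u}

/-- `Q` is the vertex set of a vertical path in the tree `T` rooted at `r`. -/
def IsVerticalPath {α : Type} (T : SimpleGraph α) (r : α) (Q : Set α) : Prop :=
  ∃ w u, IsVerticalPathBtw T r Q w u

/-- `Y` is the union of at most `k` vertical paths in the tree `T` rooted at `r`. -/
def IsUnionOfVPaths {α : Type} (T : SimpleGraph α) (r : α) (k : ℕ) (Y : Set α) : Prop :=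
  ∃ m, m ≤ k ∧ ∃ Q : Fin m → Set α, (∀ i, IsVerticalPath T r (Q i)) ∧ Y = ⋃ i, Q i

/-- The planarization of a drawing of `G` with crossings indexed by `I`, where the
`i`-th crossing is a crossing of the edges `(a i)(b i)` and `(c i)(d i)` of `G`:
each crossing is replaced by a new vertex of degree 4 joined to the four endpoints
of the two crossing edges, and the crossed edges are removed. -/
def planarization {V I : Type} (G : SimpleGraph V) (a b c d : I → V) :
    SimpleGraph (V ⊕ I) where
  Adj x y :=
    (∃ u v, x = Sum.inl u ∧ y = Sum.inl v ∧ G.Adj u v ∧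
      ∀ i, s(u, v) ≠ s(a i, b i) ∧ s(u, v) ≠ s(c i, d i)) ∨
    (∃ u i, ((x = Sum.inl u ∧ y = Sum.inr i) ∨ (x = Sum.inr i ∧ y = Sum.inl u)) ∧
      (u = a i ∨ u = b i ∨ u = c i ∨ u = d i))
  symm := by
    refine ⟨?_⟩
    rintro x y (⟨u, v, rfl, rfl, huv, hcr⟩ | ⟨u, i, h, hu⟩)
    · refine Or.inl ⟨v, u, rfl, rfl, huv.symm, fun i => ?_⟩
      refine ⟨?_, ?_⟩ <;> rw [Sym2.eq_swap (a := v) (b := u)]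
      · exact (hcr i).1
      · exact (hcr i).2
    · exact Or.inr ⟨u, i, h.elim (fun h' => Or.inr ⟨h'.2, h'.1⟩)
        (fun h' => Or.inl ⟨h'.2, h'.1⟩), hu⟩
  loopless := by
    refine ⟨?_⟩
    rintro x (⟨u, v, rfl, h, huv, -⟩ | ⟨u, i, (⟨rfl, h⟩ | ⟨rfl, h⟩), -⟩)
    · rw [Sum.inl.injEq] at h; subst h; exact G.loopless.irrefl _ huv
    · exact absurd h (by simp)
    · exact absurd h (by simp)

/-- `G` is `(g,1)`-planar: `G` can be drawn in a surface of Euler genus at most `g`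
with every edge involved in at most one crossing.  Combinatorially: there is a
collection of crossing pairs of edges of `G`, with each edge of `G` in at most one
crossing pair, whose planarization has Euler genus at most `g`. -/
def IsG1Planar {V : Type} (G : SimpleGraph V) (g : ℕ) : Prop :=
  ∃ (I : Type) (a b c d : I → V),
    (∀ i, G.Adj (a i) (b i) ∧ G.Adj (c i) (d i)) ∧
    (∀ i, s(a i, b i) ≠ s(c i, d i)) ∧
    (∀ i j, i ≠ j →
      ∀ e : Sym2 V, (e = s(a i, b i) ∨ e = s(c i, d i)) →
        (e = s(a j, b j) ∨ e = s(c j, d j)) → False) ∧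
    HasEulerGenusLE (planarization G a b c d) g


/-! ### Flag systems -/

theorem dihedral_ne {Ω : Type} (s t : Ω → Ω) (hs : ∀ a, s (s a) = a) (ht : ∀ a, t (t a) = a)
    (ns : ∀ a, s a ≠ a) (nt : ∀ a, t a ≠ a) (j : ℕ) :
    ∀ a, (fun x => t (s x))^[j] a ≠ s a := by
  induction j using Nat.strong_induction_on with
  | _ j ih =>
    intro a h
    match j, ih, h with
    | 0, _, h => exact ns a h.symm
    | 1, _, h => exact nt (s a) h
    | (k+2), ih, h =>
      rw [Function.iterate_succ_apply', Function.iterate_succ_apply] at h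
      apply ih k (by omega) (t (s a))
      have h2 := congrArg (fun x => s (t x)) h
      simpa [hs, ht] using h2

theorem dihedral_ne' {Ω : Type} (s t : Ω → Ω) (hs : ∀ a, s (s a) = a) (ht : ∀ a, t (t a) = a)
    (ns : ∀ a, s a ≠ a) (nt : ∀ a, t a ≠ a) (j : ℕ) (a : Ω) :
    (fun x => t (s x))^[j] a ≠ t a := by
  intro h
  cases j with
  | zero => exact nt a h.symm
  | succ k =>
    rw [Function.iterate_succ_apply'] at h
    apply dihedral_ne s t hs ht ns nt k a
    have h2 := congrArg (fun x => s (t x)) h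
    simpa [hs, ht] using h2

/-- A flag system: the flags of a polygonal closed surface. -/
structure FS (Ω : Type) where
  t0 : Ω → Ω
  t1 : Ω → Ω
  t2 : Ω → Ω
  i0 : ∀ a, t0 (t0 a) = a
  i1 : ∀ a, t1 (t1 a) = a
  i2 : ∀ a, t2 (t2 a) = a
  n0 : ∀ a, t0 a ≠ a
  n1 : ∀ a, t1 a ≠ a
  n2 : ∀ a, t2 a ≠ a
  comm : ∀ a, t0 (t2 a) = t2 (t0 a)
  n02 : ∀ a, t0 (t2 a) ≠ a

namespace FS

variable {Ω : Type} (S : FS Ω)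

def VR (a b : Ω) : Prop := b = S.t1 a ∨ b = S.t2 a
def ER (a b : Ω) : Prop := b = S.t0 a ∨ b = S.t2 a
def FR (a b : Ω) : Prop := b = S.t0 a ∨ b = S.t1 a
def vc (a : Ω) : Quot S.VR := Quot.mk _ a
def ec (a : Ω) : Quot S.ER := Quot.mk _ a
def fc (a : Ω) : Quot S.FR := Quot.mk _ a

@[simp] theorem vc1 (a : Ω) : S.vc (S.t1 a) = S.vc a :=
  (Quot.sound (r := S.VR) (a := a) (b := S.t1 a) (Or.inl rfl)).symm
@[simp] theorem vc2 (a : Ω) : S.vc (S.t2 a) = S.vc a :=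
  (Quot.sound (r := S.VR) (a := a) (b := S.t2 a) (Or.inr rfl)).symm
@[simp] theorem ec0 (a : Ω) : S.ec (S.t0 a) = S.ec a :=
  (Quot.sound (r := S.ER) (a := a) (b := S.t0 a) (Or.inl rfl)).symm
@[simp] theorem ec2 (a : Ω) : S.ec (S.t2 a) = S.ec a :=
  (Quot.sound (r := S.ER) (a := a) (b := S.t2 a) (Or.inr rfl)).symm
@[simp] theorem fc0 (a : Ω) : S.fc (S.t0 a) = S.fc a :=
  (Quot.sound (r := S.FR) (a := a) (b := S.t0 a) (Or.inl rfl)).symm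
@[simp] theorem fc1 (a : Ω) : S.fc (S.t1 a) = S.fc a :=
  (Quot.sound (r := S.FR) (a := a) (b := S.t1 a) (Or.inr rfl)).symm

theorem gen_ind {s t : Ω → Ω} (hs : ∀ a, s (s a) = a) (ht : ∀ a, t (t a) = a) {a b : Ω}
    (h : Quot.mk (fun a b => b = s a ∨ b = t a) a = Quot.mk _ b) (P : Ω → Prop)
    (h1 : ∀ x, P x → P (s x)) (h2 : ∀ x, P x → P (t x)) (ha : P a) : P b := by
  have key : P a ↔ P b := by
    have := Quot.eqvGen_exact h
    clear h ha
    induction this with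
    | rel x y hxy =>
      rcases hxy with rfl | rfl
      · exact ⟨h1 x, fun h => by simpa [hs] using h1 _ h⟩
      · exact ⟨h2 x, fun h => by simpa [ht] using h2 _ h⟩
    | refl x => exact Iff.rfl
    | symm x y _ ih => exact ih.symm
    | trans x y z _ _ ih1 ih2 => exact ih1.trans ih2
  exact key.1 ha

theorem v_ind {a b : Ω} (h : S.vc a = S.vc b) (P : Ω → Prop)
    (h1 : ∀ x, P x → P (S.t1 x)) (h2 : ∀ x, P x → P (S.t2 x)) (ha : P a) : P b :=
  gen_ind S.i1 S.i2 h P h1 h2 ha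

theorem e_ind {a b : Ω} (h : S.ec a = S.ec b) (P : Ω → Prop)
    (h1 : ∀ x, P x → P (S.t0 x)) (h2 : ∀ x, P x → P (S.t2 x)) (ha : P a) : P b :=
  gen_ind S.i0 S.i2 h P h1 h2 ha

theorem f_ind {a b : Ω} (h : S.fc a = S.fc b) (P : Ω → Prop)
    (h1 : ∀ x, P x → P (S.t0 x)) (h2 : ∀ x, P x → P (S.t1 x)) (ha : P a) : P b :=
  gen_ind S.i0 S.i1 h P h1 h2 ha

theorem e_cases {a b : Ω} (h : S.ec a = S.ec b) :
    b = a ∨ b = S.t0 a ∨ b = S.t2 a ∨ b = S.t0 (S.t2 a) := by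
  refine S.e_ind h (fun b => b = a ∨ b = S.t0 a ∨ b = S.t2 a ∨ b = S.t0 (S.t2 a)) ?_ ?_ (Or.inl rfl)
  · rintro x (rfl | rfl | rfl | rfl) <;> simp [S.i0]
  · rintro x (rfl | rfl | rfl | rfl) <;> simp [S.i2, S.comm]

/-- rotation along a face -/
def rho (a : Ω) : Ω := S.t1 (S.t0 a)

theorem rho_inj : Function.Injective S.rho := by
  intro a b h
  have := congrArg (fun x => S.t0 (S.t1 x)) h
  simpa [rho, S.i0, S.i1] using this

@[simp] theorem fc_rho (i : ℕ) (a : Ω) : S.fc (S.rho^[i] a) = S.fc a := by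
  induction i with
  | zero => rfl
  | succ k ih => rw [Function.iterate_succ_apply']; simp [rho, ih]

theorem rho_ne0 (j : ℕ) (a : Ω) : S.rho^[j] a ≠ S.t0 a :=
  dihedral_ne S.t0 S.t1 S.i0 S.i1 S.n0 S.n1 j a

theorem rho_ne1 (j : ℕ) (a : Ω) : S.rho^[j] a ≠ S.t1 a :=
  dihedral_ne' S.t0 S.t1 S.i0 S.i1 S.n0 S.n1 j a

theorem vc_rho (a : Ω) : S.vc (S.rho a) = S.vc (S.t0 a) := by simp [rho]

noncomputable def nV : ℕ := Nat.card (Quot S.VR)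
noncomputable def nF : ℕ := Nat.card (Quot S.FR)

theorem card_le_nV [Finite Ω] {Λ X : Type} (l : Ω → X) (h1 : ∀ a, l (S.t1 a) = l a)
    (h2 : ∀ a, l (S.t2 a) = l a) (g : Λ → Ω) (hg : Function.Injective (fun x => l (g x))) :
    Nat.card Λ ≤ S.nV := by
  apply Nat.card_le_card_of_injective (fun x => S.vc (g x))
  intro x y h
  apply hg
  exact (S.v_ind h (fun b => l (g x) = l b) (fun b hb => by rw [h1, hb])
    (fun b hb => by rw [h2, hb]) rfl)

theorem card_le_nF [Finite Ω] {Λ X : Type} (l : Ω → X) (h1 : ∀ a, l (S.t0 a) = l a)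
    (h2 : ∀ a, l (S.t1 a) = l a) (g : Λ → Ω) (hg : Function.Injective (fun x => l (g x))) :
    Nat.card Λ ≤ S.nF := by
  apply Nat.card_le_card_of_injective (fun x => S.fc (g x))
  intro x y h
  apply hg
  exact (S.f_ind h (fun b => l (g x) = l b) (fun b hb => by rw [h1, hb])
    (fun b hb => by rw [h2, hb]) rfl)

/-- all flags connected -/
def Conn : Prop := ∀ (P : Ω → Prop), (∀ x, P x → P (S.t0 x)) → (∀ x, P x → P (S.t1 x)) →
  (∀ x, P x → P (S.t2 x)) → ∀ a b, P a → P b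

theorem card_E [Finite Ω] : 4 * Nat.card (Quot S.ER) ≤ Nat.card Ω := by
  have : Nat.card (Quot S.ER × Fin 4) ≤ Nat.card Ω := by
    let a : Quot S.ER → Ω := Quot.out
    have ha : ∀ q, S.ec (a q) = q := fun q => Quot.out_eq q
    let g : Quot S.ER × Fin 4 → Ω := fun x =>
      match x.2 with
      | 0 => a x.1
      | 1 => S.t0 (a x.1)
      | 2 => S.t2 (a x.1)
      | 3 => S.t0 (S.t2 (a x.1))
    apply Nat.card_le_card_of_injective g
    have hge : ∀ x, S.ec (g x) = x.1 := by
      rintro ⟨q, i⟩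
      fin_cases i <;> simp [g, ha]
    rintro ⟨q, i⟩ ⟨q', i'⟩ h
    have hq : q = q' := by
      have h5 := congrArg S.ec h
      rwa [hge, hge] at h5
    subst hq
    have e1 := S.n0 (a q)
    have e2 := S.n2 (a q)
    have e3 := S.n02 (a q)
    have e4 := S.n0 (S.t2 (a q))
    have e5 : S.t0 (S.t2 (a q)) ≠ S.t0 (a q) := fun h => e2 (by
      have := congrArg S.t0 h; simpa [S.i0] using this)
    have e6 : S.t0 (a q) ≠ S.t2 (a q) := fun h => e3 (by rw [← h, S.i0])
    congr 1
    fin_cases i <;> fin_cases i' <;> simp [g] at h ⊢ <;>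
      first | exact e1 h | exact e1 h.symm | exact e2 h | exact e2 h.symm
            | exact e3 h | exact e3 h.symm | exact e4 h | exact e4 h.symm
            | exact e5 h | exact e5 h.symm | exact e6 h | exact e6 h.symm
  rw [Nat.card_prod, Nat.card_fin] at this
  omega

/-! ### From flag systems to embeddings -/

def graph : Multigraph (Quot S.VR) (Quot S.ER) where
  ends := Quot.lift (fun a => s(S.vc a, S.vc (S.t0 a))) (by
    rintro a b (rfl | rfl)
    · simp [S.i0, Sym2.eq_swap]
    · simp [S.comm])

@[simp] theorem graph_ends (a : Ω) : S.graph.ends (S.ec a) = s(S.vc a, S.vc (S.t0 a)) := rfl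

noncomputable def rep (f : Quot S.FR) : Ω := Quot.out f
@[simp] theorem fc_rep (f : Quot S.FR) : S.fc (S.rep f) = f := Quot.out_eq f
noncomputable def flen (f : Quot S.FR) : ℕ := Function.minimalPeriod S.rho (S.rep f)

theorem mp_pos [Finite Ω] (a : Ω) : 0 < Function.minimalPeriod S.rho a :=
  Function.minimalPeriod_pos_of_mem_periodicPts (S.rho_inj.mem_periodicPts a)

theorem iter_mod (a : Ω) (i : ℕ) :
    S.rho^[i % Function.minimalPeriod S.rho a] a = S.rho^[i] a :=
  Function.iterate_mod_minimalPeriod_eq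

noncomputable def walk [Finite Ω] (f : Quot S.FR) : S.graph.CWalk where
  len := S.flen f
  len_pos := S.mp_pos _
  vtx i := S.vc (S.rho^[i] (S.rep f))
  edge i := S.ec (S.rho^[i] (S.rep f))
  vtx_per i := by rw [flen, ← S.iter_mod _ (i + _), Nat.add_mod_right, S.iter_mod]
  edge_per i := by rw [flen, ← S.iter_mod _ (i + _), Nat.add_mod_right, S.iter_mod]
  compat i := by
    rw [graph_ends, Function.iterate_succ_apply', vc_rho]

theorem exists_pos [Finite Ω] (a : Ω) : ∃ i, i < S.flen (S.fc a) ∧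
    (a = S.rho^[i] (S.rep (S.fc a)) ∨ a = S.t0 (S.rho^[i] (S.rep (S.fc a)))) := by
  obtain ⟨w, hw⟩ : ∃ w, w = S.rep (S.fc a) := ⟨_, rfl⟩
  have hp := S.mp_pos w
  have : ∃ i, a = S.rho^[i] w ∨ a = S.t0 (S.rho^[i] w) := by
    refine S.f_ind (a := w) (b := a) (by simp [hw])
      (fun b => ∃ i, b = S.rho^[i] w ∨ b = S.t0 (S.rho^[i] w)) ?_ ?_ ⟨0, Or.inl rfl⟩
    · rintro x ⟨i, rfl | rfl⟩
      · exact ⟨i, Or.inr rfl⟩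
      · exact ⟨i, Or.inl (S.i0 _)⟩
    · rintro x ⟨i, rfl | rfl⟩
      · obtain ⟨m, hm⟩ : ∃ m, i + Function.minimalPeriod S.rho w = m + 1 := ⟨_, (Nat.succ_pred (by omega)).symm⟩
        refine ⟨m, Or.inr ?_⟩
        rw [← S.iter_mod w i, ← Nat.add_mod_right, S.iter_mod, hm, Function.iterate_succ_apply']
        simp [rho, S.i1]
      · exact ⟨i+1, Or.inl (by rw [Function.iterate_succ_apply']; rfl)⟩
  obtain ⟨i, hi⟩ := this
  refine ⟨i % Function.minimalPeriod S.rho w, ?_, ?_⟩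
  · rw [flen, ← hw]; exact Nat.mod_lt _ hp
  · rw [← hw, S.iter_mod]; exact hi

noncomputable def pos [Finite Ω] (a : Ω) : Quot S.FR × ℕ := (S.fc a, (S.exists_pos a).choose)

theorem pos_lt [Finite Ω] (a : Ω) : (S.pos a).2 < S.flen (S.pos a).1 := (S.exists_pos a).choose_spec.1
theorem pos_eq [Finite Ω] (a : Ω) : a = S.rho^[(S.pos a).2] (S.rep (S.pos a).1) ∨
    a = S.t0 (S.rho^[(S.pos a).2] (S.rep (S.pos a).1)) := (S.exists_pos a).choose_spec.2

theorem t0_inj : Function.Injective S.t0 := fun a b h => by rw [← S.i0 a, h, S.i0]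

theorem no_flip (w : Ω) (i j : ℕ) : S.rho^[i] w ≠ S.t0 (S.rho^[j] w) := by
  intro h
  rcases le_total j i with hij | hij
  · obtain ⟨k, rfl⟩ := Nat.exists_eq_add_of_le hij
    rw [add_comm, Function.iterate_add_apply] at h
    exact S.rho_ne0 _ _ h
  · obtain ⟨k, rfl⟩ := Nat.exists_eq_add_of_le hij
    rw [add_comm, Function.iterate_add_apply] at h
    apply S.rho_ne0 k (S.rho^[i] w)
    conv_rhs => rw [h]
    exact (S.i0 _).symm

theorem pos_unique [Finite Ω] (a : Ω) (f : Quot S.FR) (i : ℕ) (hi : i < S.flen f)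
    (h : a = S.rho^[i] (S.rep f) ∨ a = S.t0 (S.rho^[i] (S.rep f))) : S.pos a = (f, i) := by
  have hf : S.fc a = f := by rcases h with rfl | rfl <;> simp
  subst hf
  have h1 := S.pos_lt a
  have h2 := S.pos_eq a
  have h3 : (S.pos a).1 = S.fc a := rfl
  rw [h3] at h1 h2
  refine Prod.ext h3 ?_
  apply Function.iterate_injOn_Iio_minimalPeriod (f := S.rho) (x := S.rep (S.fc a)) h1 hi
  rcases h with h | h <;> rcases h2 with h2 | h2
  · exact h2.symm.trans h
  · exact absurd (h.symm.trans h2) (S.no_flip _ _ _)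
  · exact absurd (h2.symm.trans h) (S.no_flip _ _ _)
  · exact S.t0_inj (h2.symm.trans h)

theorem pos_t0 [Finite Ω] (a : Ω) : S.pos (S.t0 a) = S.pos a := by
  refine S.pos_unique _ (S.pos a).1 (S.pos a).2 (S.pos_lt a) ?_
  rcases S.pos_eq a with h | h
  · right; exact congrArg S.t0 h
  · left; exact (congrArg S.t0 h).trans (S.i0 _)

theorem pos_t2_ne [Finite Ω] (a : Ω) : S.pos a ≠ S.pos (S.t2 a) := by
  intro h
  have h1 := S.pos_eq a
  have h2 := S.pos_eq (S.t2 a)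
  rw [← h] at h2
  have e6 : S.t2 a ≠ S.t0 a := fun h => S.n02 a (by rw [h, S.i0])
  rcases h1 with h1 | h1 <;> rcases h2 with h2 | h2
  · exact S.n2 a (h2.trans h1.symm)
  · exact e6 (h2.trans (by rw [← h1]))
  · apply e6; rw [h2]; conv_rhs => rw [h1]
    exact (S.i0 _).symm
  · exact S.n2 a (h2.trans h1.symm)

theorem occ_iff [Finite Ω] (a : Ω) (p : Quot S.FR × ℕ) :
    Multigraph.IsOcc S.walk (S.ec a) p ↔ p = S.pos a ∨ p = S.pos (S.t2 a) := by
  constructor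
  · rintro ⟨h1, h2⟩
    have h1 : p.2 < S.flen p.1 := h1
    have h2 : S.ec (S.rho^[p.2] (S.rep p.1)) = S.ec a := h2
    have h3 : S.pos (S.rho^[p.2] (S.rep p.1)) = p := S.pos_unique _ _ _ h1 (Or.inl rfl)
    rw [← h3]
    rcases S.e_cases h2.symm with h | h | h | h <;> rw [h] <;> simp [pos_t0]
  · have key : ∀ b, S.ec b = S.ec a → Multigraph.IsOcc S.walk (S.ec a) (S.pos b) := by
      intro b hb
      refine ⟨S.pos_lt b, ?_⟩
      change S.ec (S.rho^[(S.pos b).2] (S.rep (S.pos b).1)) = _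
      rw [← hb]
      rcases S.pos_eq b with h | h
      · rw [← h]
      · conv_rhs => rw [h]
        simp
    rintro (rfl | rfl)
    · exact key _ rfl
    · exact key _ (by simp)

/-- the corner of a flag -/
noncomputable def cor [Finite Ω] (a : Ω) : Quot S.FR × ℕ :=
  open Classical in
  if a = S.rho^[(S.pos a).2] (S.rep (S.pos a).1) then S.pos a
  else ((S.pos a).1, ((S.pos a).2 + 1) % S.flen (S.pos a).1)

theorem cor_lt [Finite Ω] (a : Ω) : (S.cor a).2 < S.flen (S.cor a).1 := by
  unfold cor
  split_ifs
  · exact S.pos_lt a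
  · exact Nat.mod_lt _ (S.mp_pos _)

theorem cor_rho [Finite Ω] (f : Quot S.FR) (i : ℕ) (hi : i < S.flen f) :
    S.cor (S.rho^[i] (S.rep f)) = (f, i) := by
  have : S.pos (S.rho^[i] (S.rep f)) = (f, i) := S.pos_unique _ _ _ hi (Or.inl rfl)
  unfold cor
  rw [this]; simp

theorem cor_rho1 [Finite Ω] (f : Quot S.FR) (i : ℕ) (hi : i < S.flen f) :
    S.cor (S.t1 (S.rho^[i] (S.rep f))) = (f, i) := by
  obtain ⟨m, hm⟩ : ∃ m, i + S.flen f = m + 1 := ⟨_, (Nat.succ_pred (by omega)).symm⟩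
  have e1 : S.t1 (S.rho^[i] (S.rep f)) = S.t0 (S.rho^[m % S.flen f] (S.rep f)) := by
    have : S.rho^[i] (S.rep f) = S.rho^[m+1] (S.rep f) := by
      rw [← hm, ← S.iter_mod _ (i + _), flen, Nat.add_mod_right, S.iter_mod]
    rw [this, Function.iterate_succ_apply', flen, S.iter_mod]
    simp [rho, S.i1]
  have hp : S.pos (S.t1 (S.rho^[i] (S.rep f))) = (f, m % S.flen f) :=
    S.pos_unique _ _ _ (Nat.mod_lt _ (S.mp_pos _)) (Or.inr e1)
  unfold cor
  rw [hp, if_neg]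
  · simp only
    congr 1
    rw [Nat.mod_add_mod, ← hm, Nat.add_mod_right, Nat.mod_eq_of_lt hi]
  · rw [e1]; exact (S.no_flip _ _ _).symm

theorem cor_eq [Finite Ω] (a : Ω) : a = S.rho^[(S.cor a).2] (S.rep (S.cor a).1) ∨
    a = S.t1 (S.rho^[(S.cor a).2] (S.rep (S.cor a).1)) := by
  unfold cor
  split_ifs with h
  · exact Or.inl h
  · right
    simp only
    rw [flen, S.iter_mod, Function.iterate_succ_apply']
    simp only [rho, S.i1]
    exact (S.pos_eq a).resolve_left h

theorem cor_t1 [Finite Ω] (a : Ω) : S.cor (S.t1 a) = S.cor a := by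
  rcases S.cor_eq a with h | h
  · conv_lhs => rw [h]
    rw [cor_rho1 _ _ _ (S.cor_lt a)]
  · conv_lhs => rw [h]
    rw [S.i1, cor_rho _ _ _ (S.cor_lt a)]

theorem cor_corner [Finite Ω] (a : Ω) : Multigraph.IsCorner S.walk (S.vc a) (S.cor a) := by
  refine ⟨S.cor_lt a, ?_⟩
  change S.vc (S.rho^[(S.cor a).2] (S.rep (S.cor a).1)) = _
  rcases S.cor_eq a with h | h
  · rw [← h]
  · conv_rhs => rw [h]
    simp

theorem cor_linked [Finite Ω] (a : Ω) :
    Multigraph.CornerLinked S.walk (S.vc a) (S.cor a) (S.cor (S.t2 a)) := by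
  have key : ∀ b, Multigraph.EndOf S.walk (S.cor b) (S.pos b) := by
    intro b
    unfold cor
    split_ifs
    · exact ⟨rfl, Or.inl rfl⟩
    · exact ⟨rfl, Or.inr rfl⟩
  refine ⟨S.cor_corner a, by simpa using S.cor_corner (S.t2 a), S.ec a, S.pos a, S.pos (S.t2 a),
    S.pos_t2_ne a, (S.occ_iff a _).2 (Or.inl rfl), (S.occ_iff a _).2 (Or.inr rfl), key _, key _⟩

theorem conn_graph [Finite Ω] (hne : Nonempty Ω) (hc : S.Conn) : S.graph.simple.Connected := by
  have hn : Nonempty (Quot S.VR) := hne.map S.vc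
  rw [SimpleGraph.connected_iff]
  refine ⟨?_, hn⟩
  have key : ∀ a b : Ω, S.graph.simple.Reachable (S.vc a) (S.vc b) := by
    intro a b
    refine hc (fun b => S.graph.simple.Reachable (S.vc a) (S.vc b)) ?_ ?_ ?_ a b
      (SimpleGraph.Reachable.refl _)
    · intro x hx
      by_cases h : S.vc x = S.vc (S.t0 x)
      · rwa [← h]
      · exact hx.trans (SimpleGraph.Adj.reachable ⟨h, S.ec x, rfl⟩)
    · intro x hx; simpa using hx
    · intro x hx; simpa using hx
  rintro ⟨a⟩ ⟨b⟩
  exact key a b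

noncomputable def emb [Finite Ω] (hne : Nonempty Ω) (hc : S.Conn) : S.graph.Embedding (Quot S.FR) where
  boundary := S.walk
  conn := S.conn_graph hne hc
  edge_twice := by
    rintro ⟨a⟩
    have : {p | Multigraph.IsOcc S.walk (Quot.mk S.ER a) p} = {S.pos a, S.pos (S.t2 a)} := by
      ext p; exact S.occ_iff a p
    rw [this, Set.ncard_pair (S.pos_t2_ne a)]
  link_conn := by
    rintro v c c' ⟨h1, h2⟩ ⟨h1', h2'⟩
    obtain ⟨a, ha⟩ : ∃ a, a = S.rho^[c.2] (S.rep c.1) := ⟨_, rfl⟩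
    obtain ⟨a', ha'⟩ : ∃ a, a = S.rho^[c'.2] (S.rep c'.1) := ⟨_, rfl⟩
    have h2 : S.vc a = v := by rw [ha]; exact h2
    have h2' : S.vc a' = v := by rw [ha']; exact h2'
    have hc1 : S.cor a = c := by rw [ha]; exact S.cor_rho _ _ h1
    have hc2 : S.cor a' = c' := by rw [ha']; exact S.cor_rho _ _ h1'
    rw [← hc1, ← hc2]
    have := S.v_ind (h2.trans h2'.symm) (fun b => S.vc b = v ∧
      Relation.EqvGen (Multigraph.CornerLinked S.walk v) (S.cor a) (S.cor b)) ?_ ?_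
      ⟨h2, Relation.EqvGen.refl _⟩
    · exact this.2
    · rintro x ⟨hx, hx2⟩
      exact ⟨by simpa using hx, by rwa [S.cor_t1]⟩
    · rintro x ⟨hx, hx2⟩
      refine ⟨by simpa using hx, hx2.trans _ _ _ (Relation.EqvGen.rel _ _ ?_)⟩
      rw [← hx]; exact S.cor_linked x

theorem emb_genus [Finite Ω] (hne : Nonempty Ω) (hc : S.Conn) (g : ℕ)
    (h : Nat.card Ω + 8 ≤ 4 * S.nV + 4 * S.nF + 4 * g) : (S.emb hne hc).eulerGenus ≤ g := by
  have := S.card_E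
  unfold Multigraph.Embedding.eulerGenus
  unfold nV nF at h
  omega

theorem emb_cycle [Finite Ω] (hne : Nonempty Ω) (hc : S.Conn)
    (H1 : ∀ j a, S.vc (S.rho^[j] a) = S.vc a → S.rho^[j] a = a)
    (H2 : ∀ a, S.rho (S.rho a) ≠ a) (f : Quot S.FR) : ((S.emb hne hc).boundary f).IsCycle := by
  have H1' : ∀ i j a, S.vc (S.rho^[i] a) = S.vc (S.rho^[j] a) → S.rho^[i] a = S.rho^[j] a := by
    intro i j a h
    rcases le_total j i with hij | hij
    · obtain ⟨k, rfl⟩ := Nat.exists_eq_add_of_le hij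
      rw [add_comm, Function.iterate_add_apply] at h ⊢
      exact H1 _ _ h
    · obtain ⟨k, rfl⟩ := Nat.exists_eq_add_of_le hij
      rw [add_comm, Function.iterate_add_apply] at h ⊢
      exact (H1 _ _ h.symm).symm
  have hinj : ∀ i j, i < S.flen f → j < S.flen f → S.rho^[i] (S.rep f) = S.rho^[j] (S.rep f) → i = j :=
    fun i j hi hj h => Function.iterate_injOn_Iio_minimalPeriod (f := S.rho) (x := S.rep f) hi hj h
  constructor
  · intro i j hi hj h
    exact hinj i j hi hj (H1' i j _ h)
  · intro i j hi hj h
    have h : S.ec (S.rho^[i] (S.rep f)) = S.ec (S.rho^[j] (S.rep f)) := h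
    rcases S.e_cases h with h | h | h | h
    · exact hinj i j hi hj h.symm
    · exact absurd h (S.no_flip _ _ _)
    · apply hinj i j hi hj
      apply H1'
      rw [h]; simp
    · exfalso
      have e1 : S.vc (S.rho^[i] (S.rep f)) = S.vc (S.rho^[j+1] (S.rep f)) := by
        rw [Function.iterate_succ_apply', vc_rho, h, S.i0]; simp
      have e2 : S.vc (S.rho^[i+1] (S.rep f)) = S.vc (S.rho^[j] (S.rep f)) := by
        rw [Function.iterate_succ_apply', vc_rho, h, S.comm]; simp
      have e1 := H1' _ _ _ e1
      have e2 := H1' _ _ _ e2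
      apply H2 (S.rho^[j] (S.rep f))
      rw [← Function.iterate_succ_apply' S.rho j, ← e1, ← Function.iterate_succ_apply' S.rho i, e2]

theorem emb_hasVtx [Finite Ω] (hne : Nonempty Ω) (hc : S.Conn) (a : Ω) :
    ((S.emb hne hc).boundary (S.fc a)).HasVtx (S.vc a) := by
  have h1 := S.cor_corner a
  have h2 : (S.cor a).1 = S.fc a := by
    unfold cor
    split_ifs <;> rfl
  rw [← h2]
  exact ⟨_, h1.1, h1.2⟩

end FS

/-! ### From embeddings to flag systems -/

theorem FS.merge {Ω : Type} [Finite Ω] (S S' : FS Ω) (h1 : S'.t1 = S.t1) (α β : Ω)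
    (hne : S.vc α ≠ S.vc β) (hα : S'.t2 α = S.t2 β)
    (hx : ∀ x, x ≠ α → x ≠ β → x ≠ S.t2 α → x ≠ S.t2 β → S'.t2 x = S.t2 x) : S'.nV < S.nV := by
  have path : ∀ α β, S.vc α ≠ S.vc β →
      (∀ x, x ≠ α → x ≠ β → x ≠ S.t2 α → x ≠ S.t2 β → S'.t2 x = S.t2 x) →
      S'.vc (S.t2 α) = S'.vc α := by
    intro α β hne hx
    let r : Ω → Ω := fun x => S.t2 (S.t1 x)
    have hr : Function.Injective r := by
      intro a b h
      have := congrArg (fun x => S.t1 (S.t2 x)) h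
      simpa [r, S.i1, S.i2] using this
    have hp : 0 < Function.minimalPeriod r α :=
      Function.minimalPeriod_pos_of_mem_periodicPts (hr.mem_periodicPts α)
    have hv : ∀ i, S.vc (r^[i] α) = S.vc α := by
      intro i
      induction i with
      | zero => rfl
      | succ k ih => rw [Function.iterate_succ_apply', ← ih]; simp [r]
    have hs : ∀ i, i < Function.minimalPeriod r α → S'.vc (r^[i] α) = S'.vc α := by
      intro i
      induction i with
      | zero => intro _; rfl
      | succ k ih =>
        intro hk
        rw [← ih (by omega), Function.iterate_succ_apply']
        have e : S'.t2 (S.t1 (r^[k] α)) = S.t2 (S.t1 (r^[k] α)) := by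
          have hc : S.vc (S.t1 (r^[k] α)) = S.vc α := by simpa using hv k
          apply hx
          · intro h
            apply dihedral_ne S.t1 S.t2 S.i1 S.i2 S.n1 S.n2 k α
            change r^[k] α = _
            rw [← S.i1 (r^[k] α), h]
          · rintro h; rw [h] at hc; exact hne hc.symm
          · intro h
            have : r^[k+1] α = α := by
              rw [Function.iterate_succ_apply']; simp only [r] at h ⊢; rw [h, S.i2]
            have h3 : Function.IsPeriodicPt r (k+1) α := this
            have := h3.minimalPeriod_le (by omega)
            omega
          · rintro h; rw [h] at hc; simp at hc; exact hne hc.symm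
        change S'.vc (S.t2 (S.t1 (r^[k] α))) = _
        rw [← e, ← h1]; simp
    obtain ⟨m, hm⟩ : ∃ m, Function.minimalPeriod r α = m + 1 := ⟨_, (Nat.succ_pred (by omega)).symm⟩
    have e1 : r^[m+1] α = α := by rw [← hm]; exact Function.iterate_minimalPeriod
    rw [Function.iterate_succ_apply'] at e1
    have e2 : S.t1 (r^[m] α) = S.t2 α := by
      rw [← S.i2 (S.t1 _)]; congr 1
    rw [← e2, ← h1, S'.vc1]
    exact hs m (by omega)
  have pa := path α β hne hx
  have pb := path β α hne.symm (fun x a b c d => hx x b a d c)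
  have hall : ∀ x, S'.vc (S.t2 x) = S'.vc x := by
    intro x
    by_cases c1 : x = α
    · rw [c1, pa]
    by_cases c2 : x = β
    · rw [c2, pb]
    by_cases c3 : x = S.t2 α
    · rw [c3, S.i2, pa]
    by_cases c4 : x = S.t2 β
    · rw [c4, S.i2, pb]
    rw [← hx x c1 c2 c3 c4, S'.vc2]
  let F : Quot S.VR → Quot S'.VR := Quot.lift S'.vc (by
    rintro a b (rfl | rfl)
    · rw [← h1]; simp
    · exact (hall a).symm)
  have hF : ∀ a, F (S.vc a) = S'.vc a := fun a => rfl
  have hsur : Function.Surjective F := by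
    rintro ⟨a⟩; exact ⟨S.vc a, rfl⟩
  by_contra hlt
  have hb := (Nat.bijective_iff_surjective_and_card F).2
    ⟨hsur, le_antisymm (not_lt.1 hlt) (Nat.card_le_card_of_surjective F hsur)⟩
  apply hne
  apply hb.1
  rw [hF, hF, ← S'.vc2 α, hα, pb]

/-- The data extracted from an embedding containing the graph `A`. -/
def FS.Good {Ω : Type} (S : FS Ω) (g : ℕ) {U : Type} (A : SimpleGraph U) : Prop :=
  Finite Ω ∧ Nonempty Ω ∧ S.Conn ∧ Nat.card Ω + 8 ≤ 4 * S.nV + 4 * S.nF + 4 * g ∧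
  ∃ j : U → Quot S.VR, Function.Injective j ∧
    ∀ u u', A.Adj u u' → ∃ a, S.vc a = j u ∧ S.vc (S.t0 a) = j u'

namespace RawFS

instance {V E : Type} {M : Multigraph V E} (W : M.CWalk) : NeZero W.len := ⟨W.len_pos.ne'⟩

variable {V E F : Type} {M : Multigraph V E} (bd : F → M.CWalk)

abbrev Sd := Σ f : F, Fin (bd f).len
def eg (p : Sd bd) : E := (bd p.1).edge p.2.val
def vl (a : Sd bd × Bool) : V := (bd a.1.1).vtx (a.1.2.val + a.2.toNat)

theorem ends_eg (p : Sd bd) : M.ends (eg bd p) = s(vl bd (p, false), vl bd (p, true)) :=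
  (bd p.1).compat p.2.val

def nx (p : Sd bd) : Sd bd := ⟨p.1, p.2 + 1⟩
def pv (p : Sd bd) : Sd bd := ⟨p.1, p.2 - 1⟩

theorem vtx_mod (W : M.CWalk) (i : ℕ) : W.vtx (i % W.len) = W.vtx i := by
  have : ∀ k j, W.vtx (j + W.len * k) = W.vtx j := by
    intro k
    induction k with
    | zero => simp
    | succ k ih => intro j; rw [Nat.mul_succ, ← Nat.add_assoc, W.vtx_per, ih]
  conv_rhs => rw [← Nat.mod_add_div i W.len]
  rw [this]

theorem val_add_one {n : ℕ} [NeZero n] (i : Fin n) : (i + 1).val = (i.val + 1) % n := by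
  rw [Fin.val_add, Fin.val_one', Nat.add_mod_mod]

theorem vl_nx (p : Sd bd) : vl bd (nx bd p, false) = vl bd (p, true) := by
  simp only [vl, nx, Bool.toNat_false, Bool.toNat_true, add_zero]
  rw [val_add_one, vtx_mod]

theorem nx_pv (p : Sd bd) : nx bd (pv bd p) = p := by
  obtain ⟨f, i⟩ := p
  letI := Fin.instCommRing (bd f).len
  exact congrArg (Sigma.mk f) (sub_add_cancel i 1)
theorem pv_nx (p : Sd bd) : pv bd (nx bd p) = p := by
  obtain ⟨f, i⟩ := p
  letI := Fin.instCommRing (bd f).len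
  exact congrArg (Sigma.mk f) (add_sub_cancel_right i 1)

def T1 : Sd bd × Bool → Sd bd × Bool
  | (p, true) => (nx bd p, false)
  | (p, false) => (pv bd p, true)

theorem vl_T1 (a : Sd bd × Bool) : vl bd (T1 bd a) = vl bd a := by
  obtain ⟨p, _ | _⟩ := a
  · change vl bd (pv bd p, true) = _
    rw [← vl_nx, nx_pv]
  · exact vl_nx bd p

theorem exists_partner (h2 : ∀ e : E, {p : F × ℕ | Multigraph.IsOcc bd e p}.ncard = 2)
    (p : Sd bd) : ∃ q, q ≠ p ∧ eg bd q = eg bd p ∧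
    ∀ r, eg bd r = eg bd p → r = p ∨ r = q := by
  obtain ⟨x, y, hxy, hT⟩ := Set.ncard_eq_two.1 (h2 (eg bd p))
  have mem : ∀ r : Sd bd, eg bd r = eg bd p → ((r.1, r.2.val) = x ∨ (r.1, r.2.val) = y) := by
    intro r hr
    have : (r.1, r.2.val) ∈ {p' : F × ℕ | Multigraph.IsOcc bd (eg bd p) p'} := ⟨r.2.isLt, hr⟩
    rw [hT] at this; exact this
  have hx : Multigraph.IsOcc bd (eg bd p) x := by
    have : x ∈ ({x, y} : Set (F × ℕ)) := by simp
    rw [← hT] at this; exact this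
  have hy : Multigraph.IsOcc bd (eg bd p) y := by
    have : y ∈ ({x, y} : Set (F × ℕ)) := by simp
    rw [← hT] at this; exact this
  obtain ⟨x1, x2⟩ := x
  obtain ⟨y1, y2⟩ := y
  have key : ∀ (r : Sd bd) (z1 : F) (z2 : ℕ) (hz : z2 < (bd z1).len), (r.1, r.2.val) = (z1, z2) →
      r = ⟨z1, ⟨z2, hz⟩⟩ := by
    rintro ⟨r1, r2, hr2⟩ z1 z2 hz h
    simp only [Prod.mk.injEq] at h
    obtain ⟨rfl, rfl⟩ := h
    rfl
  have hne : (⟨x1, ⟨x2, hx.1⟩⟩ : Sd bd) ≠ ⟨y1, ⟨y2, hy.1⟩⟩ := by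
    intro h
    apply hxy
    have := congrArg (fun r : Sd bd => (r.1, r.2.val)) h
    exact this
  have mem' : ∀ r : Sd bd, eg bd r = eg bd p → r = ⟨x1, ⟨x2, hx.1⟩⟩ ∨ r = ⟨y1, ⟨y2, hy.1⟩⟩ :=
    fun r hr => (mem r hr).imp (key r _ _ _) (key r _ _ _)
  rcases mem' p rfl with h | h
  · refine ⟨⟨y1, ⟨y2, hy.1⟩⟩, fun e => hne (h.symm.trans e.symm), hy.2, ?_⟩
    intro r hr; exact (mem' r hr).imp (fun e => e.trans h.symm) id
  · refine ⟨⟨x1, ⟨x2, hx.1⟩⟩, fun e => hne (e.trans h), hx.2, ?_⟩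
    intro r hr; exact (mem' r hr).symm.imp (fun e => e.trans h.symm) id

variable (h2 : ∀ e : E, {p : F × ℕ | Multigraph.IsOcc bd e p}.ncard = 2)

noncomputable def pr (p : Sd bd) : Sd bd := (exists_partner bd h2 p).choose
theorem pr_ne (p : Sd bd) : pr bd h2 p ≠ p := (exists_partner bd h2 p).choose_spec.1
theorem eg_pr (p : Sd bd) : eg bd (pr bd h2 p) = eg bd p := (exists_partner bd h2 p).choose_spec.2.1
theorem pr_cases (p r : Sd bd) (h : eg bd r = eg bd p) : r = p ∨ r = pr bd h2 p :=
  (exists_partner bd h2 p).choose_spec.2.2 r h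
theorem pr_pr (p : Sd bd) : pr bd h2 (pr bd h2 p) = p := by
  rcases pr_cases bd h2 p (pr bd h2 (pr bd h2 p)) (by rw [eg_pr, eg_pr]) with h | h
  · exact h
  · exact absurd h (pr_ne bd h2 _)

open Classical in
noncomputable def dr (o : E → Bool) (p : Sd bd) : Bool :=
  if (M.ends (eg bd p)).IsDiag then o (eg bd p)
  else decide (vl bd (pr bd h2 p, false) ≠ vl bd (p, false))

theorem dr_pr (o : E → Bool) (p : Sd bd) : dr bd h2 o (pr bd h2 p) = dr bd h2 o p := by
  unfold dr
  rw [eg_pr, pr_pr]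
  split_ifs
  · rfl
  · exact decide_eq_decide.2 ne_comm

noncomputable def T2 (o : E → Bool) (a : Sd bd × Bool) : Sd bd × Bool :=
  (pr bd h2 a.1, xor a.2 (dr bd h2 o a.1))

theorem vl_T2 (o : E → Bool) (a : Sd bd × Bool) : vl bd (T2 bd h2 o a) = vl bd a := by
  obtain ⟨p, b⟩ := a
  have e1 := ends_eg bd p
  have e2 := ends_eg bd (pr bd h2 p)
  rw [eg_pr, e1] at e2
  unfold T2
  simp only
  unfold dr
  split_ifs with h
  · rw [e1] at h
    have h : vl bd (p, false) = vl bd (p, true) := h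
    rw [← h] at e2
    rcases Sym2.eq_iff.1 e2 with ⟨e3, e4⟩ | ⟨e3, e4⟩ <;>
      cases b <;> cases o (eg bd p) <;> simp [← e3, ← e4, ← h]
  · rw [e1] at h
    have h : vl bd (p, false) ≠ vl bd (p, true) := h
    rcases Sym2.eq_iff.1 e2 with ⟨e3, e4⟩ | ⟨e3, e4⟩
    · cases b <;> simp [← e3, ← e4]
    · cases b <;> simp [← e3, ← e4, h.symm]

noncomputable def fs (o : E → Bool) : FS (Sd bd × Bool) where
  t0 a := (a.1, !a.2)
  t1 := T1 bd
  t2 := T2 bd h2 o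
  i0 a := by simp
  i1 := by rintro ⟨p, _ | _⟩ <;> simp [T1, nx_pv, pv_nx]
  i2 := by rintro ⟨p, b⟩; simp [T2, pr_pr, dr_pr]
  n0 := by rintro ⟨p, b⟩; simp
  n1 := by rintro ⟨p, _ | _⟩ <;> simp [T1]
  n2 := by rintro ⟨p, b⟩ h; exact pr_ne bd h2 p (congrArg Prod.fst h)
  comm := by rintro ⟨p, b⟩; simp [T2]
  n02 := by rintro ⟨p, b⟩ h; exact pr_ne bd h2 p (congrArg Prod.fst h)

theorem loop_merge [Finite F] (o : E → Bool) (hmin : ∀ o', (fs bd h2 o).nV ≤ (fs bd h2 o').nV)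
    (p : Sd bd) (hl : (M.ends (eg bd p)).IsDiag) :
    (fs bd h2 o).vc (p, false) = (fs bd h2 o).vc (p, true) := by
  classical
  by_contra hne
  let o' : E → Bool := Function.update o (eg bd p) (!(o (eg bd p)))
  have := FS.merge (fs bd h2 o) (fs bd h2 o') rfl _ _ hne ?_ ?_
  · exact absurd (hmin o') (by omega)
  · simp [fs, T2, dr, hl, o']
  · rintro ⟨q, b⟩ a1 a2 a3 a4
    have hq : eg bd q ≠ eg bd p := by
      intro hq
      rcases pr_cases bd h2 p q hq with rfl | rfl
      · cases b
        · exact a1 rfl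
        · exact a2 rfl
      · simp only [fs, T2, ne_eq, Prod.mk.injEq, true_and] at a3 a4
        generalize dr bd h2 o p = c at a3 a4
        revert a3 a4
        cases b <;> cases c <;> simp
    simp [fs, T2, dr, o', Function.update_of_ne hq]

def cr (a : Sd bd × Bool) : F × ℕ := (a.1.1, (a.1.2.val + a.2.toNat) % (bd a.1.1).len)

theorem vtx_cr (a : Sd bd × Bool) : (bd (cr bd a).1).vtx (cr bd a).2 = vl bd a := by
  simp only [cr, vl]; rw [vtx_mod]

open Classical in
noncomputable def kk (o : E → Bool) (c : F × ℕ) : Option (Quot (fs bd h2 o).VR) :=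
  if h : c.2 < (bd c.1).len then some ((fs bd h2 o).vc (⟨c.1, ⟨c.2, h⟩⟩, false)) else none

theorem kk_cr (o : E → Bool) (a : Sd bd × Bool) :
    kk bd h2 o (cr bd a) = some ((fs bd h2 o).vc a) := by
  have hlt : (cr bd a).2 < (bd (cr bd a).1).len := Nat.mod_lt _ (bd _).len_pos
  unfold kk
  rw [dif_pos hlt]
  obtain ⟨p, _ | _⟩ := a
  · congr 2
    obtain ⟨f, i⟩ := p
    simp [cr, Nat.mod_eq_of_lt i.isLt]
  · rw [← (fs bd h2 o).vc1 (p, true)]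
    congr 2
    obtain ⟨f, i⟩ := p
    simp only [cr, fs, T1, nx, Bool.toNat_true, Prod.mk.injEq, and_true]
    congr 1
    apply Fin.ext
    rw [val_add_one]

theorem kk_linked [Finite F] (o : E → Bool) (hmin : ∀ o', (fs bd h2 o).nV ≤ (fs bd h2 o').nV)
    (v : V) (c c' : F × ℕ) (h : Multigraph.CornerLinked bd v c c') :
    kk bd h2 o c = kk bd h2 o c' := by
  obtain ⟨⟨hc1, hc2⟩, ⟨hc1', hc2'⟩, e, p, p', hpp, ⟨ho1, ho2⟩, ⟨ho1', ho2'⟩, he, he'⟩ := h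
  have key : ∀ (c p : F × ℕ) (ho : p.2 < (bd p.1).len), Multigraph.EndOf bd c p →
      ∃ b, c = cr bd (⟨p.1, ⟨p.2, ho⟩⟩, b) := by
    rintro ⟨c1, c2⟩ ⟨p1, p2⟩ ho ⟨h1, h | h⟩
    · refine ⟨false, ?_⟩
      simp only at h1 h ho
      subst h1 h
      simp [cr, Nat.mod_eq_of_lt ho]
    · refine ⟨true, ?_⟩
      simp only at h1 h
      subst h1 h
      simp [cr]
  obtain ⟨b, rfl⟩ := key c p ho1 he
  obtain ⟨b', rfl⟩ := key c' p' ho1' he'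
  rw [vtx_cr] at hc2 hc2'
  obtain ⟨q, hq⟩ : ∃ q : Sd bd, q = ⟨p.1, ⟨p.2, ho1⟩⟩ := ⟨_, rfl⟩
  obtain ⟨q', hq'⟩ : ∃ q : Sd bd, q = ⟨p'.1, ⟨p'.2, ho1'⟩⟩ := ⟨_, rfl⟩
  have hqq : q ≠ q' := by
    intro h
    rw [hq, hq'] at h
    exact hpp (congrArg (fun r : Sd bd => (r.1, r.2.val)) h)
  have e1 : eg bd q = e := by rw [hq]; exact ho2
  have e2 : eg bd q' = e := by rw [hq']; exact ho2'
  rw [← hq] at hc2 ⊢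
  rw [← hq'] at hc2' ⊢
  rw [kk_cr, kk_cr]
  congr 1
  have hpr : q' = pr bd h2 q :=
    (pr_cases bd h2 q q' (e2.trans e1.symm)).resolve_left (fun h => hqq h.symm)
  by_cases hl : (M.ends e).IsDiag
  · have m1 := loop_merge bd h2 o hmin q (by rwa [e1])
    have m2 := loop_merge bd h2 o hmin q' (by rwa [e2])
    have m3 := (fs bd h2 o).vc2 (q, false)
    have m4 : (fs bd h2 o).t2 (q, false) = (q', xor false (dr bd h2 o q)) := by rw [hpr]; rfl
    rw [m4] at m3
    have m5 : ∀ b, (fs bd h2 o).vc (q', b) = (fs bd h2 o).vc (q', false) := by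
      intro b; cases b
      · rfl
      · exact m2.symm
    rw [m5] at m3 ⊢
    rw [m3]
    cases b
    · rfl
    · exact m1.symm
  · rw [← (fs bd h2 o).vc2 (q, b)]
    congr 1
    have w1 := vl_T2 bd h2 o (q, b)
    have m4 : (fs bd h2 o).t2 (q, b) = (q', xor b (dr bd h2 o q)) := by rw [hpr]; rfl
    have m4' : T2 bd h2 o (q, b) = (q', xor b (dr bd h2 o q)) := m4
    rw [m4', hc2, ← hc2'] at w1
    rw [m4]
    congr 1
    by_contra hb
    apply hl
    rw [← e2, ends_eg]
    generalize (xor b (dr bd h2 o q)) = b2 at w1 hb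
    revert w1 hb
    cases b2 <;> cases b' <;> simp
    · exact fun h => h.symm

theorem raw (emb : M.Embedding F) [Finite V] [Finite E] [Finite F] [Nontrivial V] (g : ℕ)
    (hg : emb.eulerGenus ≤ g) {U : Type} (A : SimpleGraph U) (hA : A.IsContainedIn M.simple) :
    ∃ (Ω : Type) (S : FS Ω), S.Good g A := by
  classical
  have h2 := emb.edge_twice
  set bd := emb.boundary with hbd
  obtain ⟨o, hmin⟩ := Finite.exists_min (fun o : E → Bool => (fs bd h2 o).nV)
  let S := fs bd h2 o
  have hvS1 : ∀ a, vl bd (S.t1 a) = vl bd a := vl_T1 bd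
  have hvS2 : ∀ a, vl bd (S.t2 a) = vl bd a := vl_T2 bd h2 o
  have fib : ∀ a b, vl bd a = vl bd b → S.vc a = S.vc b := by
    intro a b hab
    have hca : ∀ a, Multigraph.IsCorner bd (vl bd a) (cr bd a) := fun a =>
      ⟨Nat.mod_lt _ (bd _).len_pos, vtx_cr bd a⟩
    have := emb.link_conn (vl bd a) (cr bd a) (cr bd b) (hca a) (hab ▸ hca b)
    have hk' : ∀ c c', Relation.EqvGen (Multigraph.CornerLinked bd (vl bd a)) c c' →
        kk bd h2 o c = kk bd h2 o c' := by
      intro c c' h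
      induction h with
      | rel x y h => exact kk_linked bd h2 o hmin _ _ _ h
      | refl x => rfl
      | symm x y _ ih => exact ih.symm
      | trans x y z _ _ ih1 ih2 => exact ih1.trans ih2
    have hk := hk' _ _ this
    rw [kk_cr, kk_cr] at hk
    exact Option.some.inj hk
  have cov : ∀ u u', M.simple.Adj u u' → ∃ a, vl bd a = u ∧ vl bd (S.t0 a) = u' := by
    rintro u u' ⟨hne, e, he⟩
    have : {p : F × ℕ | Multigraph.IsOcc bd e p}.Nonempty := by
      apply Set.nonempty_of_ncard_ne_zero; rw [h2]; norm_num
    obtain ⟨p, hp1, hp2⟩ := this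
    let q : Sd bd := ⟨p.1, ⟨p.2, hp1⟩⟩
    have e1 : M.ends e = s(vl bd (q, false), vl bd (q, true)) := by
      rw [← ends_eg]; congr 1; exact hp2.symm
    rw [he] at e1
    rcases Sym2.eq_iff.1 e1 with ⟨e3, e4⟩ | ⟨e3, e4⟩
    · exact ⟨(q, false), e3.symm, e4.symm⟩
    · exact ⟨(q, true), e3.symm, e4.symm⟩
  have cov1 : ∀ u, ∃ a, vl bd a = u := by
    intro u
    obtain ⟨w, hw⟩ := exists_ne u
    obtain ⟨u', hu'⟩ : ∃ u', M.simple.Adj u u' := by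
      have := emb.conn.preconnected.exists_adj_of_nontrivial u
      exact this
    obtain ⟨a, ha, -⟩ := cov u u' hu'
    exact ⟨a, ha⟩
  choose fl hfl using cov1
  have hfin : Finite (Sd bd × Bool) := inferInstance
  refine ⟨Sd bd × Bool, S, hfin, ⟨fl (Classical.arbitrary V)⟩, ?_, ?_, ?_⟩
  · intro P p0 p1 p2 a b ha
    have up : ∀ a, P a → ∀ b, vl bd a = vl bd b → P b := fun a ha b hab =>
      S.v_ind (fib a b hab) P p1 p2 ha
    obtain ⟨w⟩ := emb.conn.preconnected (vl bd a) (vl bd b)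
    have gen : ∀ u u' (w : M.simple.Walk u u'), (∀ a, vl bd a = u → P a) → ∀ b, vl bd b = u' → P b := by
      intro u u' w
      induction w with
      | nil => exact fun h => h
      | cons hadj _ ih =>
        intro h
        apply ih
        intro b hb
        obtain ⟨c, hc1, hc2⟩ := cov _ _ hadj
        exact up _ (p0 _ (h c hc1)) b (hc2.trans hb.symm)
    exact gen _ _ w (fun b hb => up a ha b hb.symm) b rfl
  · have n1 : Nat.card V ≤ S.nV := S.card_le_nV (vl bd) hvS1 hvS2 fl (by
      intro x y h; simpa [hfl] using h)
    have n2 : Nat.card F ≤ S.nF := S.card_le_nF (fun a => a.1.1) (fun a => rfl)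
      (by rintro ⟨p, _ | _⟩ <;> rfl) (fun f => (⟨f, 0⟩, false)) (fun x y h => h)
    have n3 : Nat.card (Sd bd) ≤ Nat.card (E × Bool) := by
      have ex : ∀ p : Sd bd, ∃ q, eg bd q = eg bd p := fun p => ⟨p, rfl⟩
      let fst : E → Option (Sd bd) := fun e => if h : ∃ q, eg bd q = e then some h.choose else none
      apply Nat.card_le_card_of_injective (fun p => (eg bd p, decide (some p = fst (eg bd p))))
      intro p q h
      simp only [Prod.mk.injEq, decide_eq_decide] at h
      obtain ⟨h1, h3⟩ := h
      have hex : ∃ q, eg bd q = eg bd p := ⟨p, rfl⟩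
      have hf : fst (eg bd p) = some hex.choose := dif_pos hex
      have hr := hex.choose_spec
      rw [← h1, hf] at h3
      generalize hex.choose = r at hr h3
      simp only [Option.some.injEq] at h3
      rcases pr_cases bd h2 r p hr.symm with c1 | c1 <;>
      rcases pr_cases bd h2 r q (by rw [← h1, hr]) with c2 | c2
      · rw [c1, c2]
      · rw [c1]; exact (h3.1 c1).symm
      · rw [c2]; exact (h3.2 c2)
      · rw [c1, c2]
    rw [Nat.card_prod, Nat.card_eq_fintype_card (α := Bool), Fintype.card_bool] at n3
    rw [Nat.card_prod, Nat.card_eq_fintype_card (α := Bool), Fintype.card_bool]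
    unfold Multigraph.Embedding.eulerGenus at hg
    omega
  · obtain ⟨f, hf⟩ := hA
    refine ⟨fun u => S.vc (fl (f u)), ?_, ?_⟩
    · intro u u' h
      apply hf
      have := S.v_ind h (fun b => vl bd b = f u) (fun b hb => by rw [hvS1, hb])
        (fun b hb => by rw [hvS2, hb]) (hfl _)
      rw [← this, hfl]
    · intro u u' h
      obtain ⟨a, h1, h3⟩ := cov _ _ (f.map_adj h)
      exact ⟨a, fib _ _ (by rw [h1, hfl]), fib _ _ (by rw [h3, hfl])⟩

end RawFS


/-! ### Subdividing loops -/

namespace FS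

section Sub

variable {Ω : Type} (S : FS Ω)

def Lp (a : Ω) : Prop := S.vc a = S.vc (S.t0 a)

theorem Lp0 {a : Ω} : S.Lp (S.t0 a) ↔ S.Lp a := by
  unfold Lp; rw [S.i0]; exact eq_comm
theorem Lp2 {a : Ω} : S.Lp (S.t2 a) ↔ S.Lp a := by
  unfold Lp; rw [S.comm, S.vc2, S.vc2]

open Classical in
noncomputable def s0 : Ω ⊕ {a // S.Lp a} → Ω ⊕ {a // S.Lp a}
  | Sum.inl a => if h : S.Lp a then Sum.inr ⟨a, h⟩ else Sum.inl (S.t0 a)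
  | Sum.inr a => Sum.inl a.1
def s1 : Ω ⊕ {a // S.Lp a} → Ω ⊕ {a // S.Lp a}
  | Sum.inl a => Sum.inl (S.t1 a)
  | Sum.inr a => Sum.inr ⟨S.t0 a.1, S.Lp0.2 a.2⟩
def s2 : Ω ⊕ {a // S.Lp a} → Ω ⊕ {a // S.Lp a}
  | Sum.inl a => Sum.inl (S.t2 a)
  | Sum.inr a => Sum.inr ⟨S.t2 a.1, S.Lp2.2 a.2⟩

theorem s0_pos {a : Ω} (h : S.Lp a) : S.s0 (Sum.inl a) = Sum.inr ⟨a, h⟩ := dif_pos h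
theorem s0_neg {a : Ω} (h : ¬ S.Lp a) : S.s0 (Sum.inl a) = Sum.inl (S.t0 a) := dif_neg h

noncomputable def sub : FS (Ω ⊕ {a // S.Lp a}) where
  t0 := S.s0
  t1 := S.s1
  t2 := S.s2
  i0 := by
    rintro (a | ⟨a, ha⟩)
    · by_cases h : S.Lp a
      · rw [S.s0_pos h]; rfl
      · rw [S.s0_neg h, S.s0_neg (by rwa [S.Lp0]), S.i0]
    · exact S.s0_pos ha
  i1 := by
    rintro (a | ⟨a, ha⟩) <;> simp [s1, S.i1, S.i0]
  i2 := by
    rintro (a | ⟨a, ha⟩) <;> simp [s2, S.i2]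
  n0 := by
    rintro (a | ⟨a, ha⟩)
    · by_cases h : S.Lp a
      · rw [S.s0_pos h]; simp
      · rw [S.s0_neg h]; simpa using S.n0 a
    · simp [s0]
  n1 := by
    rintro (a | ⟨a, ha⟩) <;> simp [s1, S.n1, S.n0]
  n2 := by
    rintro (a | ⟨a, ha⟩) <;> simp [s2, S.n2]
  comm := by
    rintro (a | ⟨a, ha⟩)
    · by_cases h : S.Lp a
      · rw [S.s0_pos h]; simp only [s2]; rw [S.s0_pos]
      · rw [S.s0_neg h]; simp only [s2]; rw [S.s0_neg (by rwa [S.Lp2]), S.comm]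
    · rfl
  n02 := by
    rintro (a | ⟨a, ha⟩)
    · by_cases h : S.Lp (S.t2 a)
      · simp only [s2]; rw [S.s0_pos h]; simp
      · simp only [s2]; rw [S.s0_neg h]; simpa using S.n02 a
    · simp [s0, s2]

theorem sub_t0 (x) : S.sub.t0 x = S.s0 x := rfl

def slab : Ω ⊕ {a // S.Lp a} → Quot S.VR ⊕ Quot S.ER
  | Sum.inl a => Sum.inl (S.vc a)
  | Sum.inr a => Sum.inr (S.ec a.1)

theorem slab1 (x) : S.slab (S.sub.t1 x) = S.slab x := by
  rcases x with a | ⟨a, ha⟩ <;> simp [sub, s1, slab]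
theorem slab2 (x) : S.slab (S.sub.t2 x) = S.slab x := by
  rcases x with a | ⟨a, ha⟩ <;> simp [sub, s2, slab]
theorem slab_vc {x y} (h : S.sub.vc x = S.sub.vc y) : S.slab x = S.slab y :=
  S.sub.v_ind h (fun b => S.slab x = S.slab b) (fun b hb => by rw [slab1, hb])
    (fun b hb => by rw [slab2, hb]) rfl

theorem sub_loopless (x) : S.sub.vc x ≠ S.sub.vc (S.sub.t0 x) := by
  intro h
  have h := S.slab_vc h
  rcases x with a | ⟨a, ha⟩
  · by_cases hl : S.Lp a
    · change S.slab (Sum.inl a) = S.slab (S.s0 (Sum.inl a)) at h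
      rw [S.s0_pos hl] at h; simp [slab] at h
    · change S.slab (Sum.inl a) = S.slab (S.s0 (Sum.inl a)) at h
      rw [S.s0_neg hl] at h
      simp only [slab, Sum.inl.injEq] at h
      exact hl h
  · simp [sub, s0, slab] at h

theorem sub_good {g : ℕ} {U : Type} {A : SimpleGraph U} (hS : S.Good g A) : S.sub.Good g A := by
  classical
  obtain ⟨hfin, hne, hc, hcard, j, hj, hA⟩ := hS
  refine ⟨inferInstance, hne.map Sum.inl, ?_, ?_, ?_⟩
  · intro P p0 p1 p2 x y hx
    have hl0 : ∀ a, P (Sum.inl a) → P (Sum.inl (S.t0 a)) := by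
      intro a ha
      have := p0 _ ha
      rw [sub_t0] at this
      by_cases hl : S.Lp a
      · rw [S.s0_pos hl] at this
        exact p0 _ (p1 _ this)
      · rwa [S.s0_neg hl] at this
    obtain ⟨a, ha⟩ : ∃ a, P (Sum.inl a) := by
      rcases x with a | ⟨a, ha⟩
      · exact ⟨a, hx⟩
      · exact ⟨a, p0 _ hx⟩
    have all : ∀ b, P (Sum.inl b) := fun b =>
      hc (fun b => P (Sum.inl b)) hl0 (fun x hx => p1 _ hx) (fun x hx => p2 _ hx) a b ha
    rcases y with b | ⟨b, hb⟩
    · exact all b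
    · have := p0 _ (all b)
      rw [sub_t0] at this
      rwa [S.s0_pos hb] at this
  · let Λ := {e : Quot S.ER // ∃ a, S.ec a = e ∧ S.Lp a}
    have nv : Nat.card (Quot S.VR ⊕ Λ) ≤ S.sub.nV := by
      refine S.sub.card_le_nV S.slab S.slab1 S.slab2
        (Sum.elim (fun v => Sum.inl v.out) (fun e => Sum.inr ⟨e.2.choose, e.2.choose_spec.2⟩)) ?_
      rintro (v | e) (v' | e') h
      · simp only [Sum.elim_inl, slab, Sum.inl.injEq] at h ⊢
        rw [← Quot.out_eq v, ← Quot.out_eq v']; exact h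
      · simp [slab] at h
      · simp [slab] at h
      · simp only [Sum.elim_inr, slab, Sum.inr.injEq] at h ⊢
        apply Subtype.ext
        rw [← e.2.choose_spec.1, ← e'.2.choose_spec.1]; exact h
    have nf : Nat.card (Quot S.FR) ≤ S.sub.nF := by
      refine S.sub.card_le_nF (Sum.elim (fun a => S.fc a) (fun a => S.fc a.1)) ?_ ?_
        (fun f => Sum.inl f.out) ?_
      · rintro (a | ⟨a, ha⟩)
        · by_cases hl : S.Lp a
          · rw [sub_t0, S.s0_pos hl]; rfl
          · rw [sub_t0, S.s0_neg hl]; simp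
        · rfl
      · rintro (a | ⟨a, ha⟩) <;> simp [sub, s1]
      · intro f f' h
        rw [← Quot.out_eq f, ← Quot.out_eq f']; exact h
    have nl : Nat.card {a // S.Lp a} ≤ Nat.card (Λ × Bool × Bool) := by
      let r : Λ → Ω := fun e => e.2.choose
      have hr : ∀ e, S.ec (r e) = e.1 := fun e => e.2.choose_spec.1
      have hr' : ∀ e, S.Lp (r e) := fun e => e.2.choose_spec.2
      let G : Λ × Bool × Bool → {a // S.Lp a} := fun x => match x with
        | (e, false, false) => ⟨r e, hr' e⟩
        | (e, false, true) => ⟨S.t0 (r e), S.Lp0.2 (hr' e)⟩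
        | (e, true, false) => ⟨S.t2 (r e), S.Lp2.2 (hr' e)⟩
        | (e, true, true) => ⟨S.t0 (S.t2 (r e)), S.Lp0.2 (S.Lp2.2 (hr' e))⟩
      apply Nat.card_le_card_of_surjective G
      rintro ⟨a, ha⟩
      let e : Λ := ⟨S.ec a, a, rfl, ha⟩
      rcases S.e_cases (hr e) with h | h | h | h
      · exact ⟨(e, false, false), Subtype.ext h.symm⟩
      · exact ⟨(e, false, true), Subtype.ext h.symm⟩
      · exact ⟨(e, true, false), Subtype.ext h.symm⟩
      · exact ⟨(e, true, true), Subtype.ext h.symm⟩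
    rw [Nat.card_prod, Nat.card_prod, Nat.card_eq_fintype_card (α := Bool), Fintype.card_bool] at nl
    rw [Nat.card_sum] at nv ⊢
    unfold FS.nV FS.nF at *
    omega
  · let J : Quot S.VR → Quot S.sub.VR := Quot.lift (fun a => S.sub.vc (Sum.inl a)) (by
      rintro a b (rfl | rfl)
      · exact (S.sub.vc1 (Sum.inl a)).symm
      · exact (S.sub.vc2 (Sum.inl a)).symm)
    have hJ : ∀ a, J (S.vc a) = S.sub.vc (Sum.inl a) := fun a => rfl
    refine ⟨fun u => J (j u), ?_, ?_⟩
    · intro u u' h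
      apply hj
      obtain ⟨a, ha⟩ := Quot.exists_rep (j u)
      obtain ⟨b, hb⟩ := Quot.exists_rep (j u')
      simp only [← ha, ← hb] at h ⊢
      have := S.slab_vc h
      exact Sum.inl.inj this
    · intro u u' h
      obtain ⟨a, h1, h2⟩ := hA u u' h
      refine ⟨Sum.inl a, by simp only [← h1]; rfl, ?_⟩
      have : ¬ S.Lp a := by
        intro hl
        apply h.ne
        apply hj
        rw [← h1, ← h2]; exact hl
      rw [sub_t0, S.s0_neg this]
      simp only [← h2]; rfl

end Sub

end FS


/-! ### First return maps around crossing vertices -/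

/-- A loopless flag system with a set `X` of crossing vertices and a set `B` of selected flags. -/
structure Cut (Ω : Type) extends FS Ω where
  X : Quot toFS.VR → Prop
  B : Ω → Prop
  ll : ∀ a, toFS.vc a ≠ toFS.vc (t0 a)
  B1 : ∀ a, B a → B (t2 a)
  BX : ∀ a, B a → X (toFS.vc a)
  B0 : ∀ a, B a → ¬ X (toFS.vc (t0 a))
  B3 : ∀ a b, B a → B b → toFS.vc a = toFS.vc b → toFS.vc (t0 a) = toFS.vc (t0 b) →
    b = a ∨ b = t2 a
  B4 : ∀ x, X x → ∀ p q, ∃ a, B a ∧ toFS.vc a = x ∧ toFS.vc (t0 a) ≠ p ∧ toFS.vc (t0 a) ≠ q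

namespace Cut

variable {Ω : Type} (C : Cut Ω)

def rr (a : Ω) : Ω := C.t2 (C.t1 a)

theorem rr_inj : Function.Injective C.rr := by
  intro a b h
  have := congrArg (fun x => C.t1 (C.t2 x)) h
  simpa [rr, C.i1, C.i2] using this

@[simp] theorem vc_rr (i : ℕ) (a : Ω) : C.vc (C.rr^[i] a) = C.vc a := by
  induction i with
  | zero => rfl
  | succ k ih => rw [Function.iterate_succ_apply']; simp [rr, ih]

theorem ex [Finite Ω] (a : Ω) (h : C.X (C.vc a)) : ∃ j, C.B (C.t1 (C.rr^[j] a)) := by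
  obtain ⟨b, hb, hba, -⟩ := C.B4 _ h (C.vc a) (C.vc a)
  have hp : 0 < Function.minimalPeriod C.rr a :=
    Function.minimalPeriod_pos_of_mem_periodicPts (C.rr_inj.mem_periodicPts a)
  have back : ∀ i, ∃ m, C.t2 (C.rr^[i] a) = C.t1 (C.rr^[m] a) := by
    intro i
    obtain ⟨m, hm⟩ : ∃ m, i + Function.minimalPeriod C.rr a = m + 1 :=
      ⟨_, (Nat.succ_pred (by omega)).symm⟩
    refine ⟨m, ?_⟩
    have : C.rr^[i] a = C.rr^[m+1] a := by
      rw [← hm, Function.iterate_add_apply, Function.iterate_minimalPeriod]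
    rw [this, Function.iterate_succ_apply']
    simp [rr, C.i2]
  have : ∃ i, b = C.rr^[i] a ∨ b = C.t1 (C.rr^[i] a) := by
    refine C.v_ind hba.symm (fun b => ∃ i, b = C.rr^[i] a ∨ b = C.t1 (C.rr^[i] a)) ?_ ?_
      ⟨0, Or.inl rfl⟩
    · rintro x ⟨i, rfl | rfl⟩
      · exact ⟨i, Or.inr rfl⟩
      · exact ⟨i, Or.inl (C.i1 _)⟩
    · rintro x ⟨i, rfl | rfl⟩
      · obtain ⟨m, hm⟩ := back i
        exact ⟨m, Or.inr hm⟩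
      · exact ⟨i+1, Or.inl (by rw [Function.iterate_succ_apply']; rfl)⟩
  obtain ⟨i, rfl | rfl⟩ := this
  · obtain ⟨m, hm⟩ := back i
    exact ⟨m, by rw [← hm]; exact C.B1 _ hb⟩
  · exact ⟨i, hb⟩

open Classical in
noncomputable def h (a : Ω) : Ω :=
  if h : ∃ j, C.B (C.t1 (C.rr^[j] a)) then C.t1 (C.rr^[Nat.find h] a) else a

open Classical in
noncomputable def h' (a : Ω) : Ω := if C.B a then a else C.h (C.t2 a)

@[simp] theorem vc_h (a : Ω) : C.vc (C.h a) = C.vc a := by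
  unfold h; split_ifs <;> simp
@[simp] theorem vc_h' (a : Ω) : C.vc (C.h' a) = C.vc a := by
  unfold h'; split_ifs <;> simp

theorem h_i {a : Ω} (hb : C.B (C.t1 a)) : C.h a = C.t1 a := by
  classical
  have e : ∃ j, C.B (C.t1 (C.rr^[j] a)) := ⟨0, hb⟩
  unfold h
  rw [dif_pos e]
  have : Nat.find e = 0 := (Nat.find_eq_zero e).2 hb
  rw [this]; rfl

theorem h_ii [Finite Ω] {a : Ω} (hx : C.X (C.vc a)) (hb : ¬ C.B (C.t1 a)) :
    C.h a = C.h (C.t2 (C.t1 a)) := by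
  classical
  have e := C.ex a hx
  have e' := C.ex (C.t2 (C.t1 a)) (by simpa using hx)
  unfold h
  rw [dif_pos e, dif_pos e']
  have : Nat.find e = Nat.find e' + 1 := Nat.find_comp_succ e e' hb
  rw [this, Function.iterate_succ_apply]; rfl

theorem h_mem [Finite Ω] {a : Ω} (hx : C.X (C.vc a)) : C.B (C.h a) := by
  classical
  have e := C.ex a hx
  unfold h; rw [dif_pos e]; exact Nat.find_spec e

theorem h_ne [Finite Ω] {a : Ω} (hx : C.X (C.vc a)) : C.h a ≠ a := by
  classical
  have e := C.ex a hx
  unfold h; rw [dif_pos e]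
  intro h
  apply dihedral_ne C.t1 C.t2 C.i1 C.i2 C.n1 C.n2 (Nat.find e) a
  exact (C.i1 _).symm.trans (congrArg C.t1 h)

theorem h_t1 [Finite Ω] {a : Ω} (hx : C.X (C.vc a)) : C.h (C.t1 a) = C.h' a := by
  unfold h'
  split_ifs with hb
  · rw [C.h_i (by rwa [C.i1]), C.i1]
  · rw [C.h_ii (by simpa using hx) (by rwa [C.i1]), C.i1]

theorem h'_t1 [Finite Ω] {a : Ω} (hx : C.X (C.vc a)) : C.h' (C.t1 a) = C.h a := by
  rw [← C.h_t1 (by simpa using hx), C.i1]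

noncomputable def psi (a : Ω) : Sym2 Ω := s(C.h a, C.h' a)

theorem psi_t1 [Finite Ω] {a : Ω} (hx : C.X (C.vc a)) : C.psi (C.t1 a) = C.psi a := by
  unfold psi; rw [C.h_t1 hx, C.h'_t1 hx, Sym2.eq_swap]

theorem psi_t2 {a : Ω} (hb : ¬ C.B a) : C.psi (C.t2 a) = C.psi a := by
  have hb' : ¬ C.B (C.t2 a) := fun h => hb (by simpa [C.i2] using C.B1 _ h)
  unfold psi h'
  rw [if_neg hb, if_neg hb', C.i2, Sym2.eq_swap]

theorem psi_B {a : Ω} (hb : C.B a) : C.psi a = s(C.h a, a) := by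
  unfold psi h'; rw [if_pos hb]

theorem psi_h [Finite Ω] {a : Ω} (hx : C.X (C.vc a)) : C.psi (C.h a) = C.psi a := by
  have key : ∀ n a, C.X (C.vc a) → C.B (C.t1 (C.rr^[n] a)) → C.psi (C.h a) = C.psi a := by
    intro n
    induction n with
    | zero =>
      intro a hx hb
      rw [C.h_i (a := a) hb, C.psi_t1 hx]
    | succ k ih =>
      intro a hx hb
      by_cases hb1 : C.B (C.t1 a)
      · rw [C.h_i hb1, C.psi_t1 hx]
      · rw [C.h_ii hx hb1, ih _ (by simpa using hx) (by rwa [Function.iterate_succ_apply] at hb),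
          C.psi_t2 hb1, C.psi_t1 hx]
  obtain ⟨n, hn⟩ := C.ex a hx
  exact key n a hx hn

theorem h'_eq [Finite Ω] {a : Ω} (hx : C.X (C.vc a)) : C.h' a = C.h (C.h a) := by
  have := C.psi_h hx
  rw [C.psi_B (C.h_mem hx)] at this
  unfold psi at this
  rcases Sym2.eq_iff.1 this with ⟨e1, e2⟩ | ⟨e1, e2⟩
  · rw [e1, ← e2]
  · exact e1.symm

theorem hh [Finite Ω] {a : Ω} (hb : C.B a) : C.h (C.h a) = a := by
  rw [← C.h'_eq (C.BX _ hb)]; unfold h'; rw [if_pos hb]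

theorem O_lem [Finite Ω] (O : Ω → Prop) (hO : ∀ a, O a → C.B a) (h1 : ∀ a, O a → O (C.h a))
    (h2 : ∀ a, O a → O (C.t2 a)) {b b' : Ω} (hb : O b) (hb' : C.B b') (hv : C.vc b = C.vc b') :
    O b' := by
  have hX : C.X (C.vc b) := C.BX _ (hO _ hb)
  have := C.v_ind hv (fun a => C.vc a = C.vc b ∧ O (C.h a)) ?_ ?_ ⟨rfl, h1 _ hb⟩
  · rw [← C.hh hb']; exact h1 _ this.2
  · rintro x ⟨hx, hx2⟩
    refine ⟨by simpa using hx, ?_⟩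
    have hxX : C.X (C.vc x) := by rwa [hx]
    rw [C.h_t1 hxX, C.h'_eq hxX]; exact h1 _ hx2
  · rintro x ⟨hx, hx2⟩
    refine ⟨by simpa using hx, ?_⟩
    have hxX : C.X (C.vc x) := by rwa [hx]
    by_cases hB : C.B x
    · have := h1 _ hx2
      rw [C.hh hB] at this
      exact h1 _ (h2 _ this)
    · have : C.h' x = C.h (C.t2 x) := by unfold h'; rw [if_neg hB]
      rw [← this, C.h'_eq hxX]; exact h1 _ hx2

theorem twist [Finite Ω] {a : Ω} (hb : C.B a) : C.t2 (C.h (C.t2 (C.h a))) ≠ a := by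
  intro e
  have e' : C.h (C.t2 (C.h a)) = C.t2 a := by rw [← C.i2 (C.h (C.t2 (C.h a))), e]
  have hX := C.BX _ hb
  have hB := C.h_mem hX
  have e2 : C.h (C.t2 a) = C.t2 (C.h a) := by rw [← e', C.hh (C.B1 _ hB)]
  obtain ⟨b, hb1, hb2, hb3, hb4⟩ := C.B4 _ hX (C.vc (C.t0 a)) (C.vc (C.t0 (C.h a)))
  have := C.O_lem (fun x => x = a ∨ x = C.t2 a ∨ x = C.h a ∨ x = C.t2 (C.h a)) ?_ ?_ ?_
    (b := a) (b' := b) (Or.inl rfl) hb1 hb2.symm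
  · rcases this with rfl | rfl | rfl | rfl
    · exact hb3 rfl
    · rw [C.comm] at hb3; simp at hb3
    · exact hb4 rfl
    · rw [C.comm] at hb4; simp at hb4
  · rintro x (rfl | rfl | rfl | rfl)
    · exact hb
    · exact C.B1 _ hb
    · exact hB
    · exact C.B1 _ hB
  · rintro x (rfl | rfl | rfl | rfl)
    · simp
    · simp [e2]
    · simp [C.hh hb]
    · simp [e']
  · rintro x (rfl | rfl | rfl | rfl) <;> simp [C.i2]

theorem nbr_ne [Finite Ω] {a : Ω} (hb : C.B a) : C.vc (C.t0 a) ≠ C.vc (C.t0 (C.h a)) := by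
  intro e
  have hX := C.BX _ hb
  rcases C.B3 a (C.h a) hb (C.h_mem hX) (by simp) e with e | e
  · exact C.h_ne hX e
  · apply C.twist hb
    rw [e, C.i2, e, C.i2]

end Cut


/-! ### The surgery -/

inductive FL (Ω β : Type) : Type
  | T0 (a : Ω)
  | T1 (a : Ω)
  | T2 (a : Ω)
  | Y1 (b : β)
  | Y2 (b : β)
  | Y3 (b : β)
  | K (b : β)

def FL.code {Ω β : Type} : FL Ω β → (Fin 3 × Ω) ⊕ (Fin 4 × β)
  | .T0 a => .inl (0, a)
  | .T1 a => .inl (1, a)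
  | .T2 a => .inl (2, a)
  | .Y1 a => .inr (0, a)
  | .Y2 a => .inr (1, a)
  | .Y3 a => .inr (2, a)
  | .K a => .inr (3, a)

theorem FL.code_inj {Ω β : Type} : Function.Injective (FL.code (Ω := Ω) (β := β)) := by
  intro x y h
  cases x <;> cases y <;> simp [FL.code] at h ⊢ <;> exact h

instance {Ω β : Type} [Finite Ω] [Finite β] : Finite (FL Ω β) :=
  Finite.of_injective _ FL.code_inj

theorem FL.card_le {Ω β : Type} [Finite Ω] [Finite β] :
    Nat.card (FL Ω β) ≤ 3 * Nat.card Ω + 4 * Nat.card β := by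
  have := Nat.card_le_card_of_injective _ (FL.code_inj (Ω := Ω) (β := β))
  simpa [Nat.card_sum, Nat.card_prod] using this

namespace Cut

open FL

variable {Ω : Type} (C : Cut Ω)

abbrev Bs := {a // C.B a}
abbrev Fl := FL Ω C.Bs

def tt (b : C.Bs) : C.Bs := ⟨C.t2 b.1, C.B1 _ b.2⟩
theorem tt_tt (b : C.Bs) : C.tt (C.tt b) = b := Subtype.ext (C.i2 _)
theorem tt_ne (b : C.Bs) : C.tt b ≠ b := fun h => C.n2 b.1 (congrArg Subtype.val h)

noncomputable def th [Finite Ω] (b : C.Bs) : C.Bs := ⟨C.h b.1, C.h_mem (C.BX _ b.2)⟩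
theorem th_th [Finite Ω] (b : C.Bs) : C.th (C.th b) = b := Subtype.ext (C.hh b.2)
theorem th_ne [Finite Ω] (b : C.Bs) : C.th b ≠ b :=
  fun h => C.h_ne (C.BX _ b.2) (congrArg Subtype.val h)

noncomputable def u0 [Finite Ω] : C.Fl → C.Fl
  | T0 a => T0 (C.t0 a)
  | T1 a => T2 a
  | T2 a => T1 a
  | Y1 b => Y2 b
  | Y2 b => Y1 b
  | Y3 b => Y3 (C.th b)
  | K b => K (C.th b)

noncomputable def u1 [Finite Ω] : C.Fl → C.Fl
  | T0 a => T1 a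
  | T1 a => T0 a
  | T2 a => T2 (C.t0 a)
  | Y1 b => Y1 (C.th b)
  | Y2 b => Y3 b
  | Y3 b => Y2 b
  | K b => K (C.tt b)

open Classical in
noncomputable def u2 : C.Fl → C.Fl
  | T0 a => if h : C.B a then Y1 ⟨a, h⟩ else
      if h : C.B (C.t0 a) then Y2 ⟨C.t0 a, h⟩ else T0 (C.t2 a)
  | T1 a => T1 (C.t1 a)
  | T2 a => T2 (C.t1 a)
  | Y1 b => T0 b.1
  | Y2 b => T0 (C.t0 b.1)
  | Y3 b => K b
  | K b => Y3 b

theorem B_not {a : Ω} (h : C.B (C.t0 a)) : ¬ C.B a := fun h' => C.B0 _ h' (C.BX _ h)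
theorem B2 {a : Ω} : C.B (C.t2 a) ↔ C.B a :=
  ⟨fun h => by simpa [C.i2] using C.B1 _ h, C.B1 _⟩

theorem u2_B {a : Ω} (h : C.B a) : C.u2 (T0 a) = Y1 ⟨a, h⟩ := dif_pos h
theorem u2_B0 {a : Ω} (h : C.B (C.t0 a)) : C.u2 (T0 a) = Y2 ⟨C.t0 a, h⟩ :=
  (dif_neg (C.B_not h)).trans (dif_pos h)
theorem u2_n {a : Ω} (h : ¬ C.B a) (h' : ¬ C.B (C.t0 a)) : C.u2 (T0 a) = T0 (C.t2 a) :=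
  (dif_neg h).trans (dif_neg h')
theorem u2_Y2 (b : C.Bs) : C.u2 (T0 (C.t0 b.1)) = Y2 b := by
  rw [C.u2_B0 (by rw [C.i0]; exact b.2)]
  congr 1; exact Subtype.ext (C.i0 _)
theorem u2_n' {a : Ω} (h : ¬ C.B a) (h' : ¬ C.B (C.t0 a)) : C.u2 (T0 (C.t2 a)) = T0 a := by
  rw [C.u2_n (by rwa [C.B2]) (by rwa [C.comm, C.B2]), C.i2]

noncomputable def new [Finite Ω] : FS C.Fl where
  t0 := C.u0
  t1 := C.u1
  t2 := C.u2
  i0 := by rintro (a | a | a | b | b | b | b) <;> simp [u0, C.i0, C.th_th]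
  i1 := by rintro (a | a | a | b | b | b | b) <;> simp [u1, C.i0, C.th_th, C.tt_tt]
  i2 := by
    rintro (a | a | a | b | b | b | b)
    · by_cases h : C.B a
      · rw [C.u2_B h]; rfl
      by_cases h' : C.B (C.t0 a)
      · rw [C.u2_B0 h']; simp [u2, C.i0]
      · rw [C.u2_n h h', C.u2_n' h h']
    · simp [u2, C.i1]
    · simp [u2, C.i1]
    · exact C.u2_B b.2
    · exact C.u2_Y2 b
    · rfl
    · rfl
  n0 := by rintro (a | a | a | b | b | b | b) <;> simp [u0, C.n0, C.th_ne]
  n1 := by rintro (a | a | a | b | b | b | b) <;> simp [u1, C.n0, C.th_ne, C.tt_ne]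
  n2 := by
    rintro (a | a | a | b | b | b | b)
    · by_cases h : C.B a
      · rw [C.u2_B h]; simp
      by_cases h' : C.B (C.t0 a)
      · rw [C.u2_B0 h']; simp
      · rw [C.u2_n h h']; simpa using C.n2 a
    all_goals simp [u2, C.n1]
  comm := by
    rintro (a | a | a | b | b | b | b)
    · by_cases h : C.B a
      · rw [C.u2_B h]
        simp only [u0]
        exact (C.u2_Y2 ⟨a, h⟩).symm
      by_cases h' : C.B (C.t0 a)
      · rw [C.u2_B0 h']; simp only [u0]
        rw [C.u2_B h']
      · rw [C.u2_n h h']; simp only [u0]; rw [C.u2_n h' (by rwa [C.i0]), C.comm]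
    · rfl
    · rfl
    · simp only [u0]; rfl
    · simp [u0, u2, C.i0]
    · rfl
    · rfl
  n02 := by
    rintro (a | a | a | b | b | b | b)
    · by_cases h : C.B a
      · rw [C.u2_B h]; simp [u0]
      by_cases h' : C.B (C.t0 a)
      · rw [C.u2_B0 h']; simp [u0]
      · rw [C.u2_n h h']; simpa [u0] using C.n02 a
    all_goals simp [u0, u2]

open Classical in
noncomputable def La (a : Ω) : Sym2 Ω ⊕ Quot C.VR ⊕ Quot C.FR :=
  if C.X (C.vc a) then Sum.inl (C.psi a) else Sum.inr (Sum.inl (C.vc a))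

theorem La_X {a : Ω} (h : C.X (C.vc a)) : C.La a = Sum.inl (C.psi a) := if_pos h
theorem La_n {a : Ω} (h : ¬ C.X (C.vc a)) : C.La a = Sum.inr (Sum.inl (C.vc a)) := if_neg h

section

variable [Finite Ω]

noncomputable def lv : C.Fl → Sym2 Ω ⊕ Quot C.VR ⊕ Quot C.FR
  | T0 a => C.La a
  | T1 a => C.La a
  | T2 a => Sum.inr (Sum.inr (C.fc a))
  | Y1 b => Sum.inl (C.psi b.1)
  | Y2 b => Sum.inr (Sum.inl (C.vc (C.t0 b.1)))
  | Y3 b => Sum.inr (Sum.inl (C.vc (C.t0 b.1)))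
  | K b => Sum.inr (Sum.inl (C.vc (C.t0 b.1)))

noncomputable def lf : C.Fl → Sym2 Ω ⊕ Sym2 Ω ⊕ Quot C.VR
  | T0 a => Sum.inl s(a, C.t0 a)
  | T1 a => Sum.inl s(a, C.t0 a)
  | T2 a => Sum.inl s(a, C.t0 a)
  | Y1 b => Sum.inr (Sum.inl (C.psi b.1))
  | Y2 b => Sum.inr (Sum.inl (C.psi b.1))
  | Y3 b => Sum.inr (Sum.inl (C.psi b.1))
  | K b => Sum.inr (Sum.inr (C.vc b.1))

theorem psi_th (b : C.Bs) : C.psi (C.th b).1 = C.psi b.1 := C.psi_h (C.BX _ b.2)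

theorem lv1 (x) : C.lv (C.new.t1 x) = C.lv x := by
  change C.lv (C.u1 x) = C.lv x
  rcases x with (a | a | a | b | b | b | b) <;> simp [u1, lv, psi_th, tt, C.comm]

theorem lv2 (x) : C.lv (C.new.t2 x) = C.lv x := by
  change C.lv (C.u2 x) = C.lv x
  rcases x with (a | a | a | b | b | b | b)
  · by_cases h : C.B a
    · rw [C.u2_B h]; simp only [lv]; rw [C.La_X (C.BX _ h)]
    by_cases h' : C.B (C.t0 a)
    · rw [C.u2_B0 h']; simp only [lv]
      have := C.B0 _ h'
      rw [C.i0] at this ⊢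
      rw [C.La_n this]
    · rw [C.u2_n h h']; simp only [lv]; unfold La; rw [C.psi_t2 h, C.vc2]
  · simp only [lv, u2]
    by_cases hX : C.X (C.vc a)
    · unfold La; rw [C.psi_t1 hX, C.vc1]
    · rw [C.La_n hX, C.La_n (by simpa using hX), C.vc1]
  · simp [lv, u2]
  · simp only [lv, u2]; rw [C.La_X (C.BX _ b.2)]
  · simp only [lv, u2]; rw [C.La_n (C.B0 _ b.2)]
  · rfl
  · rfl

theorem lf0 (x) : C.lf (C.new.t0 x) = C.lf x := by
  change C.lf (C.u0 x) = C.lf x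
  rcases x with (a | a | a | b | b | b | b)
  · simp only [lf, u0]; rw [C.i0, Sym2.eq_swap]
  · rfl
  · rfl
  · rfl
  · rfl
  · simp [lf, u0, psi_th]
  · simp [lf, u0, th]

theorem lf1 (x) : C.lf (C.new.t1 x) = C.lf x := by
  change C.lf (C.u1 x) = C.lf x
  rcases x with (a | a | a | b | b | b | b)
  · rfl
  · rfl
  · simp only [lf, u1]; rw [C.i0, Sym2.eq_swap]
  · simp [lf, u1, psi_th]
  · rfl
  · rfl
  · simp [lf, u1, tt]

theorem lv_vc {x y} (h : C.new.vc x = C.new.vc y) : C.lv x = C.lv y :=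
  C.new.v_ind h (fun b => C.lv x = C.lv b) (fun b hb => by rw [lv1, hb])
    (fun b hb => by rw [lv2, hb]) rfl

theorem lf_fc {x y} (h : C.new.fc x = C.new.fc y) : C.lf x = C.lf y :=
  C.new.f_ind h (fun b => C.lf x = C.lf b) (fun b hb => by rw [lf0, hb])
    (fun b hb => by rw [lf1, hb]) rfl

theorem card2 {A Y : Type} [Finite A] [Finite Y] (f : A → Y) (σ : A → A)
    (h : ∀ a b, f a = f b → b = a ∨ b = σ a) : Nat.card A ≤ 2 * Nat.card {y // ∃ a, f a = y} := by
  have : Nat.card A ≤ Nat.card (Bool × {y // ∃ a, f a = y}) := by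
    apply Nat.card_le_card_of_surjective
      (fun x => if x.1 then (x.2.2.choose) else σ (x.2.2.choose))
    intro b
    let y : {y // ∃ a, f a = y} := ⟨f b, b, rfl⟩
    rcases h y.2.choose b y.2.choose_spec with e | e
    · exact ⟨(true, y), e.symm⟩
    · exact ⟨(false, y), e.symm⟩
  rwa [Nat.card_prod, Nat.card_eq_fintype_card (α := Bool), Fintype.card_bool] at this

theorem new_card (g : ℕ) (hc : Nat.card Ω + 8 ≤ 4 * C.nV + 4 * C.nF + 4 * g) :
    Nat.card C.Fl + 8 ≤ 4 * C.new.nV + 4 * C.new.nF + 4 * g := by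
  classical
  let PB := {y // ∃ b : C.Bs, C.psi b.1 = y}
  let PT := {y // ∃ a : Ω, s(a, C.t0 a) = y}
  have c0 := FL.card_le (Ω := Ω) (β := C.Bs)
  have cB : Nat.card C.Bs ≤ 2 * Nat.card PB := card2 (fun b : C.Bs => C.psi b.1) C.th (by
    intro b b' h
    rw [C.psi_B b.2, C.psi_B b'.2] at h
    rcases Sym2.eq_iff.1 h with ⟨-, e⟩ | ⟨e, -⟩
    · exact Or.inl (Subtype.ext e.symm)
    · exact Or.inr (Subtype.ext e.symm))
  have cT : Nat.card Ω ≤ 2 * Nat.card PT := card2 (fun a => s(a, C.t0 a)) C.t0 (by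
    intro b b' h
    rcases Sym2.eq_iff.1 h with ⟨e, -⟩ | ⟨-, e⟩
    · exact Or.inl e.symm
    · exact Or.inr e.symm)
  have cX : Nat.card {v // C.X v} + Nat.card {v // ¬ C.X v} = Nat.card (Quot C.VR) := by
    rw [← Nat.card_sum]
    exact Nat.card_congr (Equiv.sumCompl C.X)
  have cV : Nat.card ({v // ¬ C.X v} ⊕ Quot C.FR ⊕ PB) ≤ C.new.nV := by
    refine C.new.card_le_nV C.lv C.lv1 C.lv2 (Sum.elim (fun v => T0 v.1.out)
      (Sum.elim (fun f => T2 f.out) (fun p => Y1 p.2.choose))) ?_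
    have e1 : ∀ v : {v // ¬ C.X v}, C.lv (T0 v.1.out) = Sum.inr (Sum.inl v.1) := by
      intro v
      have : C.vc v.1.out = v.1 := Quot.out_eq _
      have h2 : C.La v.1.out = Sum.inr (Sum.inl (C.vc v.1.out)) := C.La_n (by rw [this]; exact v.2)
      rw [this] at h2
      exact h2
    have e2 : ∀ f : Quot C.FR, C.lv (T2 f.out) = Sum.inr (Sum.inr f) := fun f => by
      have : C.fc f.out = f := Quot.out_eq _
      simp only [lv]; rw [this]
    have e3 : ∀ p : PB, C.lv (Y1 p.2.choose) = Sum.inl p.1 := fun p => by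
      simp only [lv]; rw [p.2.choose_spec]
    rintro (v | f | p) (v' | f' | p') h <;> simp [e1, e2, e3] at h ⊢
    · exact Subtype.ext h
    · exact h
    · exact Subtype.ext h
  have cF : Nat.card (PT ⊕ PB ⊕ {v // C.X v}) ≤ C.new.nF := by
    have ex : ∀ v : {v // C.X v}, ∃ b : C.Bs, C.vc b.1 = v.1 := fun v => by
      obtain ⟨a, h1, h2, -⟩ := C.B4 v.1 v.2 v.1 v.1
      exact ⟨⟨a, h1⟩, h2⟩
    refine C.new.card_le_nF C.lf C.lf0 C.lf1 (Sum.elim (fun p => T0 p.2.choose)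
      (Sum.elim (fun p => Y1 p.2.choose) (fun v => K (ex v).choose))) ?_
    have e1 : ∀ p : PT, C.lf (T0 p.2.choose) = Sum.inl p.1 := fun p => by
      simp only [lf]; rw [p.2.choose_spec]
    have e2 : ∀ p : PB, C.lf (Y1 p.2.choose) = Sum.inr (Sum.inl p.1) := fun p => by
      simp only [lf]; rw [p.2.choose_spec]
    have e3 : ∀ v, C.lf (K (ex v).choose) = Sum.inr (Sum.inr v.1) := fun v => by
      simp only [lf]; rw [(ex v).choose_spec]
    rintro (v | f | p) (v' | f' | p') h <;> simp [e1, e2, e3] at h ⊢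
    · exact Subtype.ext h
    · exact Subtype.ext h
    · exact Subtype.ext h
  simp only [Nat.card_sum] at cV cF
  unfold FS.nV FS.nF at *
  change Nat.card (FL Ω C.Bs) + 8 ≤ _
  omega

end

end Cut


namespace Cut

open FL

section

variable {Ω : Type} (C : Cut Ω) [Finite Ω]

theorem La_ne (a : Ω) : C.La a ≠ C.La (C.t0 a) := by
  intro h
  have hl := C.ll a
  by_cases h1 : C.X (C.vc a) <;> by_cases h2 : C.X (C.vc (C.t0 a))
  · rw [C.La_X h1, C.La_X h2] at h
    have h := Sum.inl.inj h
    unfold psi at h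
    apply hl
    rcases Sym2.eq_iff.1 h with ⟨e, -⟩ | ⟨e, -⟩
    · have := congrArg C.vc e; simpa using this
    · have := congrArg C.vc e; simpa using this
  · rw [C.La_X h1, C.La_n h2] at h; simp at h
  · rw [C.La_n h1, C.La_X h2] at h; simp at h
  · rw [C.La_n h1, C.La_n h2] at h
    exact hl (Sum.inl.inj (Sum.inr.inj h))

theorem La_fc (a : Ω) (f : Quot C.FR) : C.La a ≠ Sum.inr (Sum.inr f) := by
  unfold La; split_ifs <;> simp

theorem rT0 (a : Ω) : C.new.rho (T0 a) = T1 (C.t0 a) := rfl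
theorem rT1 (a : Ω) : C.new.rho (T1 a) = T2 (C.t0 a) := rfl
theorem rT2 (a : Ω) : C.new.rho (T2 a) = T0 a := rfl
theorem rY1 (b : C.Bs) : C.new.rho (Y1 b) = Y3 b := rfl
theorem rY2 (b : C.Bs) : C.new.rho (Y2 b) = Y1 (C.th b) := rfl
theorem rY3 (b : C.Bs) : C.new.rho (Y3 b) = Y2 (C.th b) := rfl
theorem rK (b : C.Bs) : C.new.rho (K b) = K (C.tt (C.th b)) := rfl

theorem tri (x : C.Fl) (hx : ∀ b, x ≠ K b) : C.new.rho (C.new.rho (C.new.rho x)) = x ∧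
    C.lv (C.new.rho x) ≠ C.lv x ∧ C.lv (C.new.rho (C.new.rho x)) ≠ C.lv x := by
  rcases x with (a | a | a | b | b | b | b)
  · simp only [rT0, rT1, rT2, C.i0, lv, true_and]
    exact ⟨(C.La_ne a).symm, (C.La_fc _ _).symm⟩
  · simp only [rT0, rT1, rT2, C.i0, lv, true_and]
    exact ⟨(C.La_fc _ _).symm, (C.La_ne a).symm⟩
  · simp only [rT0, rT1, rT2, C.i0, lv, true_and]
    exact ⟨C.La_fc _ _, C.La_fc _ _⟩
  · simp [rY1, rY2, rY3, C.th_th, lv]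
  · have := C.nbr_ne b.2
    simp only [rY1, rY2, rY3, C.th_th, lv, true_and]
    refine ⟨by simp, fun h => this.symm (Sum.inl.inj (Sum.inr.inj h))⟩
  · have := C.nbr_ne b.2
    simp only [rY1, rY2, rY3, C.th_th, lv, true_and]
    refine ⟨fun h => this.symm (Sum.inl.inj (Sum.inr.inj h)), by simp⟩
  · exact absurd rfl (hx b)

theorem K_iter (i : ℕ) (b : C.Bs) : ∃ b' : C.Bs, C.new.rho^[i] (K b) = K b' ∧ C.vc b'.1 = C.vc b.1 := by
  induction i with
  | zero => exact ⟨b, rfl, rfl⟩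
  | succ k ih =>
    obtain ⟨b', h1, h2⟩ := ih
    refine ⟨C.tt (C.th b'), by rw [Function.iterate_succ_apply', h1, rK], ?_⟩
    simp [tt, th, h2]

theorem H1l (i : ℕ) (x : C.Fl) (h : C.lv (C.new.rho^[i] x) = C.lv x) : C.new.rho^[i] x = x := by
  by_cases hx : ∃ b, x = K b
  · obtain ⟨b, rfl⟩ := hx
    obtain ⟨b', h1, h2⟩ := C.K_iter i b
    rw [h1] at h
    have h := Sum.inl.inj (Sum.inr.inj h)
    rcases C.B3 b.1 b'.1 b.2 b'.2 h2.symm h.symm with e | e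
    · rw [h1, Subtype.ext e]
    · exfalso
      have e : b' = C.tt b := Subtype.ext e
      apply C.new.rho_ne1 i (K b)
      rw [h1, e]; rfl
  · push Not at hx
    obtain ⟨t1, t2, t3⟩ := C.tri x hx
    have per : Function.IsPeriodicPt C.new.rho 3 x := t1
    rw [← per.iterate_mod_apply i] at h ⊢
    have hlt : i % 3 < 3 := Nat.mod_lt _ (by norm_num)
    generalize i % 3 = m at h hlt ⊢
    interval_cases m
    · rfl
    · exact absurd h t2
    · exact absurd h t3

theorem H1l' (i j : ℕ) (x : C.Fl) (h : C.lv (C.new.rho^[i] x) = C.lv (C.new.rho^[j] x)) :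
    C.new.rho^[i] x = C.new.rho^[j] x := by
  rcases le_total j i with hij | hij
  · obtain ⟨k, rfl⟩ := Nat.exists_eq_add_of_le hij
    rw [add_comm, Function.iterate_add_apply] at h ⊢
    exact C.H1l _ _ h
  · obtain ⟨k, rfl⟩ := Nat.exists_eq_add_of_le hij
    rw [add_comm, Function.iterate_add_apply] at h ⊢
    exact (C.H1l _ _ h.symm).symm

theorem H2l (x : C.Fl) : C.new.rho (C.new.rho x) ≠ x := by
  by_cases hx : ∃ b, x = K b
  · obtain ⟨b, rfl⟩ := hx
    rw [rK, rK]
    intro h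
    have h := FL.K.inj h
    exact C.twist b.2 (congrArg Subtype.val h)
  · push Not at hx
    obtain ⟨t1, t2, t3⟩ := C.tri x hx
    intro h; rw [h] at t3; exact t3 rfl

theorem n_t0 (x) : C.new.t0 x = C.u0 x := rfl
theorem n_t1 (x) : C.new.t1 x = C.u1 x := rfl
theorem n_t2 (x) : C.new.t2 x = C.u2 x := rfl

theorem new_conn (hc : C.Conn) : C.new.Conn := by
  intro P p0 p1 p2 x y hx
  have q01 : ∀ a, P (T0 a) → P (T1 a) := fun a h => p1 _ h
  have q10 : ∀ a, P (T1 a) → P (T0 a) := fun a h => p1 _ h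
  have q23 : ∀ b, P (Y2 b) → P (Y3 b) := fun a h => p1 _ h
  have q32 : ∀ b, P (Y3 b) → P (Y2 b) := fun a h => p1 _ h
  have q3k : ∀ b, P (Y3 b) → P (K b) := fun a h => p2 _ h
  have qk3 : ∀ b, P (K b) → P (Y3 b) := fun a h => p2 _ h
  have q20 : ∀ b : C.Bs, P (Y2 b) → P (T0 (C.t0 b.1)) := fun a h => p2 _ h
  have q02 : ∀ b : C.Bs, P (T0 (C.t0 b.1)) → P (Y2 b) := fun b h => by
    have := p2 _ h; rwa [n_t2, C.u2_Y2] at this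
  have qt : ∀ b : C.Bs, P (Y2 b) → P (Y2 (C.tt b)) := fun b h =>
    q32 _ (qk3 _ (p1 _ (q3k _ (q23 _ h))))
  have q0 : ∀ a, P (T0 a) → P (T0 (C.t0 a)) := fun a h => p0 _ h
  have st : ∃ a, P (T0 a) := by
    rcases x with (a | a | a | b | b | b | b)
    · exact ⟨a, hx⟩
    · exact ⟨a, q10 _ hx⟩
    · exact ⟨a, q10 _ (p0 _ hx)⟩
    · exact ⟨_, p2 _ hx⟩
    · exact ⟨_, p2 _ hx⟩
    · exact ⟨_, q20 _ (q32 _ hx)⟩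
    · exact ⟨_, q20 _ (q32 _ (qk3 _ hx))⟩
  obtain ⟨a0, ha0⟩ := st
  have all : ∀ a, P (T0 a) := by
    intro a
    refine hc (fun a => P (T0 a)) q0 ?_ ?_ a0 a ha0
    · intro a ha
      exact q10 _ (p2 _ (q01 _ ha))
    · intro a ha
      by_cases h : C.B a
      · have := q20 _ (qt _ (q02 ⟨a, h⟩ (q0 _ ha)))
        have := q0 _ this
        simpa [tt, C.i0] using this
      by_cases h' : C.B (C.t0 a)
      · have := q20 _ (qt _ (q02 ⟨C.t0 a, h'⟩ (by simpa [C.i0] using ha)))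
        simpa [tt, C.i0, C.comm] using this
      · have := p2 _ ha
        rwa [n_t2, C.u2_n h h'] at this
  rcases y with (a | a | a | b | b | b | b)
  · exact all a
  · exact q01 _ (all a)
  · exact p0 _ (q01 _ (all a))
  · have := p2 _ (all b.1)
    rwa [n_t2, C.u2_B b.2] at this
  · exact q02 _ (all _)
  · exact q23 _ (q02 _ (all _))
  · exact q3k _ (q23 _ (q02 _ (all _)))

theorem vcK (b : C.Bs) : C.new.vc (K b) = C.new.vc (T0 (C.t0 b.1)) := by
  have e1 : C.new.t2 (K b) = Y3 b := rfl
  have e2 : C.new.t1 (Y3 b) = Y2 b := rfl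
  have e3 : C.new.t2 (Y2 b) = T0 (C.t0 b.1) := rfl
  rw [← C.new.vc2 (K b), e1, ← C.new.vc1, e2, ← C.new.vc2, e3]

theorem vcK_tt (b : C.Bs) : C.new.vc (K (C.tt b)) = C.new.vc (K b) := C.new.vc1 (K b)

theorem fibre {a a' : Ω} (h : C.vc a = C.vc a') (hX : ¬ C.X (C.vc a)) :
    C.new.vc (T0 a) = C.new.vc (T0 a') := by
  refine (C.v_ind h (fun b => C.vc b = C.vc a ∧ C.new.vc (T0 a) = C.new.vc (T0 b)) ?_ ?_
    ⟨rfl, rfl⟩).2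
  · rintro x ⟨h1, h2⟩
    refine ⟨by simpa using h1, h2.trans ?_⟩
    have e1 : C.new.t1 (T0 x) = T1 x := rfl
    have e2 : C.new.t2 (T1 x) = T1 (C.t1 x) := rfl
    have e3 : C.new.t1 (T1 (C.t1 x)) = T0 (C.t1 x) := rfl
    rw [← C.new.vc1 (T0 x), e1, ← C.new.vc2, e2, ← C.new.vc1, e3]
  · rintro x ⟨h1, h2⟩
    refine ⟨by simpa using h1, h2.trans ?_⟩
    by_cases h : C.B x
    · exact absurd (C.BX _ h) (by rwa [h1])
    by_cases h' : C.B (C.t0 x)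
    · have e1 := C.vcK ⟨C.t0 x, h'⟩
      have e2 := C.vcK (C.tt ⟨C.t0 x, h'⟩)
      rw [C.vcK_tt, e1] at e2
      simpa [tt, C.i0, C.comm] using e2
    · have := C.new.vc2 (T0 x)
      rw [n_t2, C.u2_n h h'] at this
      exact this.symm

theorem faceK (b b' : C.Bs) (h : C.vc b.1 = C.vc b'.1) : C.new.fc (K b) = C.new.fc (K b') := by
  have := C.O_lem (fun a => ∃ h : C.B a, C.new.fc (K b) = C.new.fc (K ⟨a, h⟩)) ?_ ?_ ?_
    (b := b.1) (b' := b'.1) ⟨b.2, rfl⟩ b'.2 h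
  · obtain ⟨_, h⟩ := this; exact h
  · rintro a ⟨h, -⟩; exact h
  · rintro a ⟨h, h1⟩
    exact ⟨C.h_mem (C.BX _ h), h1.trans (C.new.fc0 (K ⟨a, h⟩)).symm⟩
  · rintro a ⟨h, h1⟩
    exact ⟨C.B1 _ h, h1.trans (C.new.fc1 (K ⟨a, h⟩)).symm⟩

theorem lenK (b : C.Bs) (s : Finset (Quot C.VR))
    (hs : ∀ b' : C.Bs, C.vc b'.1 = C.vc b.1 → C.vc (C.t0 b'.1) ∈ s) :
    C.new.flen (C.new.fc (K b)) ≤ s.card := by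
  classical
  have h1 := C.lf_fc (C.new.fc_rep (C.new.fc (K b)))
  unfold FS.flen
  generalize C.new.rep (C.new.fc (K b)) = r at h1
  have : ∃ b1 : C.Bs, r = K b1 ∧ C.vc b1.1 = C.vc b.1 := by
    rcases r with (a | a | a | b1 | b1 | b1 | b1) <;> simp [lf] at h1
    exact ⟨b1, rfl, h1⟩
  obtain ⟨b1, rfl, hb1⟩ := this
  have key := Finset.card_le_card_of_injOn (s := Finset.range (Function.minimalPeriod C.new.rho (K b1)))
    (t := s.image (fun v => (Sum.inr (Sum.inl v) : Sym2 Ω ⊕ Quot C.VR ⊕ Quot C.FR)))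
    (fun i => C.lv (C.new.rho^[i] (K b1))) ?_ ?_
  · rw [Finset.card_range] at key
    exact key.trans Finset.card_image_le
  · intro i _
    obtain ⟨b2, h3, h4⟩ := C.K_iter i b1
    simp only [h3, lv]
    exact Finset.mem_coe.2 (Finset.mem_image.2 ⟨_, hs b2 (h4.trans hb1), rfl⟩)
  · intro i hi j hj h
    simp only [Finset.coe_range] at hi hj
    exact Function.iterate_injOn_Iio_minimalPeriod hi hj (C.H1l' i j _ h)

end

end Cut


theorem cut_exists {Ω V I : Type} (S : FS Ω) (hl : ∀ x, S.vc x ≠ S.vc (S.t0 x))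
    (a b c d : I → V) (j : V ⊕ I → Quot S.VR) (hj : Function.Injective j)
    (hab : ∀ i, a i ≠ b i) (hcd : ∀ i, c i ≠ d i) (hne : ∀ i, s(a i, b i) ≠ s(c i, d i))
    (hA : ∀ i u, (u = a i ∨ u = b i ∨ u = c i ∨ u = d i) →
      ∃ x, S.vc x = j (Sum.inr i) ∧ S.vc (S.t0 x) = j (Sum.inl u)) :
    ∃ C : Cut Ω, C.toFS = S ∧ (∀ u, ¬ ∃ x : Ω, C.X (C.vc x) ∧ S.vc x = j (Sum.inl u)) ∧
      (∀ x, C.B x → ∃ i u, (u = a i ∨ u = b i ∨ u = c i ∨ u = d i) ∧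
        S.vc x = j (Sum.inr i) ∧ S.vc (S.t0 x) = j (Sum.inl u)) ∧
      (∀ i u, (u = a i ∨ u = b i ∨ u = c i ∨ u = d i) →
        ∃ x, C.B x ∧ S.vc x = j (Sum.inr i) ∧ S.vc (S.t0 x) = j (Sum.inl u)) := by
  choose sel hs1 hs2 using hA
  let B : Ω → Prop := fun x => ∃ i u hu, x = sel i u hu ∨ x = S.t2 (sel i u hu)
  have hB : ∀ x, B x → ∃ i u, (u = a i ∨ u = b i ∨ u = c i ∨ u = d i) ∧
        S.vc x = j (Sum.inr i) ∧ S.vc (S.t0 x) = j (Sum.inl u) := by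
    rintro x ⟨i, u, hu, rfl | rfl⟩
    · exact ⟨i, u, hu, hs1 _ _ _, hs2 _ _ _⟩
    · exact ⟨i, u, hu, by simp [hs1], by simp [S.comm, hs2]⟩
  have hB' : ∀ i u, (u = a i ∨ u = b i ∨ u = c i ∨ u = d i) →
        ∃ x, B x ∧ S.vc x = j (Sum.inr i) ∧ S.vc (S.t0 x) = j (Sum.inl u) :=
    fun i u hu => ⟨sel i u hu, ⟨i, u, hu, Or.inl rfl⟩, hs1 _ _ _, hs2 _ _ _⟩
  let X : Quot S.VR → Prop := fun v => ∃ i, v = j (Sum.inr i)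
  have hX : ∀ u, ¬ X (j (Sum.inl u)) := by
    rintro u ⟨i, h⟩
    have := hj h
    simp at this
  refine ⟨{ toFS := S, X := X, B := B, ll := hl, B1 := ?_, BX := ?_, B0 := ?_, B3 := ?_, B4 := ?_ },
    rfl, ?_, hB, hB'⟩
  · rintro x ⟨i, u, hu, rfl | rfl⟩
    · exact ⟨i, u, hu, Or.inr rfl⟩
    · exact ⟨i, u, hu, Or.inl (S.i2 _)⟩
  · intro x hx
    obtain ⟨i, u, -, h, -⟩ := hB x hx
    exact ⟨i, h⟩
  · intro x hx
    obtain ⟨i, u, -, -, h⟩ := hB x hx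
    rw [h]; exact hX u
  · have vB : ∀ x i u hu, x = sel i u hu ∨ x = S.t2 (sel i u hu) →
        S.vc x = j (Sum.inr i) ∧ S.vc (S.t0 x) = j (Sum.inl u) := by
      rintro x i u hu (rfl | rfl)
      · exact ⟨hs1 _ _ _, hs2 _ _ _⟩
      · exact ⟨by simp [hs1], by simp [S.comm, hs2]⟩
    rintro x y ⟨i, u, hu, hx⟩ ⟨i', u', hu', hy⟩ h1 h2
    obtain ⟨x1, x2⟩ := vB x i u hu hx
    obtain ⟨y1, y2⟩ := vB y i' u' hu' hy
    rw [x1, y1] at h1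
    rw [x2, y2] at h2
    have h1 := Sum.inr.inj (hj h1)
    have h2 := Sum.inl.inj (hj h2)
    subst h1 h2
    rcases hx with rfl | rfl <;> rcases hy with rfl | rfl <;> simp [S.i2]
  · rintro x ⟨i, rfl⟩ p q
    by_contra hcon
    push Not at hcon
    have key : ∀ u, (u = a i ∨ u = b i ∨ u = c i ∨ u = d i) →
        j (Sum.inl u) = p ∨ j (Sum.inl u) = q := by
      intro u hu
      obtain ⟨y, y1, y2, y3⟩ := hB' i u hu
      by_cases h : S.vc (S.t0 y) = p
      · left; rw [← y3, h]
      · right; rw [← y3]; exact hcon y y1 y2 h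
    have inj : ∀ u u' r, j (Sum.inl u) = r → j (Sum.inl u') = r → u = u' :=
      fun u u' r h h' => Sum.inl.inj (hj (h.trans h'.symm))
    apply hne i
    rw [Sym2.eq_iff]
    rcases key (a i) (by simp) with ha | ha <;> rcases key (b i) (by simp) with hb | hb <;>
      rcases key (c i) (by simp) with hc | hc <;> rcases key (d i) (by simp) with hd | hd <;>
      first
      | exact absurd (inj _ _ _ ha hb) (hab i)
      | exact absurd (inj _ _ _ hc hd) (hcd i)
      | exact Or.inl ⟨inj _ _ _ ha hc, inj _ _ _ hb hd⟩
      | exact Or.inr ⟨inj _ _ _ ha hd, inj _ _ _ hb hc⟩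
  · rintro u ⟨x, h1, h2⟩
    have h1 : X (S.vc x) := h1
    rw [h2] at h1
    exact hX u h1

/-- For every surface `Σ`, every `(Σ,1)`-planar graph `G` with at least three vertices is
contained in `G₀^{(4)}` for some multigraph `G₀` embedded in `Σ` with no crossings,
where each face of `G₀` is bounded by a cycle. -/
theorem one_planar_framed (g : ℕ) {V : Type} [Fintype V] (G : SimpleGraph V)
    (hcard : 3 ≤ Fintype.card V) (hG : IsG1Planar G g) :
    ∃ (V₀ E₀ F₀ : Type), Finite V₀ ∧ Finite E₀ ∧ Finite F₀ ∧
      ∃ (G₀ : Multigraph V₀ E₀) (emb₀ : G₀.Embedding F₀),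
        (∀ f, (emb₀.boundary f).IsCycle) ∧
        emb₀.eulerGenus ≤ (g : ℤ) ∧
        G.IsContainedIn (Multigraph.framedGraph emb₀ 4) := by

  classical
  obtain ⟨I, a, b, c, d, hadj, hne, -, V', E', F', _, _, _, M, emb, hg, hA⟩ := hG
  have hnt : Nontrivial V' := by
    obtain ⟨f, hf⟩ := hA
    have : Nontrivial V := Fintype.one_lt_card_iff_nontrivial.1 (by omega)
    exact (hf.comp Sum.inl_injective).nontrivial
  obtain ⟨Ω0, S0, h0⟩ := RawFS.raw emb g hg _ hA
  have h1 := S0.sub_good h0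
  have hl := S0.sub_loopless
  generalize hS : S0.sub = S at h1 hl
  obtain ⟨hfin, hnon, hconn, hcd, j, hj, hAdj⟩ := h1
  obtain ⟨C, hCS, hX, hB, hB'⟩ := cut_exists S hl a b c d j hj (fun i => (hadj i).1.ne)
    (fun i => (hadj i).2.ne) hne (fun i u hu => hAdj _ _ (Or.inr ⟨u, i, Or.inr ⟨rfl, rfl⟩, hu⟩))
  subst hCS
  have hn' : Nonempty C.Fl := hnon.map FL.T0
  have hc' := C.new_conn hconn
  have rep : ∀ u : V, ∃ x, C.vc x = j (Sum.inl u) := fun u => Quot.exists_rep _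
  choose w hw using rep
  have hwX : ∀ u, ¬ C.X (C.vc (w u)) := fun u h => hX u ⟨w u, h, hw u⟩
  have hfib : ∀ x u, C.vc x = j (Sum.inl u) → C.new.vc (FL.T0 x) = C.new.vc (FL.T0 (w u)) :=
    fun x u h => (C.fibre ((hw u).trans h.symm) (hwX u)).symm
  have hφ : Function.Injective (fun u => C.new.vc (FL.T0 (w u))) := by
    intro u u' h
    have h := C.lv_vc h
    change C.La (w u) = C.La (w u') at h
    rw [C.La_n (hwX u), C.La_n (hwX u'), hw, hw] at h
    exact Sum.inl.inj (hj (Sum.inl.inj (Sum.inr.inj h)))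
  have cross : ∀ i u u', (u = a i ∨ u = b i ∨ u = c i ∨ u = d i) →
      (u' = a i ∨ u' = b i ∨ u' = c i ∨ u' = d i) →
      ∃ f, ((C.new.emb hn' hc').boundary f).len ≤ 4 ∧
        ((C.new.emb hn' hc').boundary f).HasVtx (C.new.vc (FL.T0 (w u))) ∧
        ((C.new.emb hn' hc').boundary f).HasVtx (C.new.vc (FL.T0 (w u'))) := by
    intro i u u' hu hu'
    obtain ⟨x, x1, x2, x3⟩ := hB' i u hu
    obtain ⟨y, y1, y2, y3⟩ := hB' i u' hu'
    refine ⟨C.new.fc (FL.K ⟨x, x1⟩), ?_, ?_, ?_⟩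
    · refine (C.lenK ⟨x, x1⟩ {j (Sum.inl (a i)), j (Sum.inl (b i)), j (Sum.inl (c i)),
        j (Sum.inl (d i))} ?_).trans Finset.card_le_four
      rintro ⟨z, z1⟩ hz
      obtain ⟨i', v, hv, z2, z3⟩ := hB z z1
      have : i' = i := Sum.inr.inj (hj (z2.symm.trans (hz.trans x2)))
      subst this
      simp only [z3, Finset.mem_insert, Finset.mem_singleton]
      rcases hv with rfl | rfl | rfl | rfl <;> simp
    · have := C.new.emb_hasVtx hn' hc' (FL.K ⟨x, x1⟩)
      rw [C.vcK, hfib _ u x3] at this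
      exact this
    · rw [C.faceK ⟨x, x1⟩ ⟨y, y1⟩ (x2.trans y2.symm)]
      have := C.new.emb_hasVtx hn' hc' (FL.K ⟨y, y1⟩)
      rw [C.vcK, hfib _ u' y3] at this
      exact this
  refine ⟨Quot C.new.VR, Quot C.new.ER, Quot C.new.FR, inferInstance, inferInstance, inferInstance,
    C.new.graph, C.new.emb hn' hc', ?_, ?_, ?_⟩
  · exact C.new.emb_cycle hn' hc' (fun i x h => C.H1l i x (C.lv_vc h)) C.H2l
  · exact C.new.emb_genus hn' hc' g (C.new_card g hcd)
  · refine ⟨⟨fun u => C.new.vc (FL.T0 (w u)), ?_⟩, hφ⟩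
    intro u v huv
    refine ⟨fun h => huv.ne (hφ h), ?_⟩
    by_cases hcr : ∀ i, s(u, v) ≠ s(a i, b i) ∧ s(u, v) ≠ s(c i, d i)
    · left
      obtain ⟨x, x1, x2⟩ := hAdj (Sum.inl u) (Sum.inl v) (Or.inl ⟨u, v, rfl, rfl, huv, hcr⟩)
      refine ⟨C.new.ec (FL.T0 x), ?_⟩
      rw [FS.graph_ends, hfib x u x1]
      have : C.new.t0 (FL.T0 x) = FL.T0 (C.t0 x) := rfl
      rw [this, hfib _ v x2]
    · right
      push Not at hcr
      obtain ⟨i, hi⟩ := hcr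
      by_cases h : s(u, v) = s(a i, b i)
      · rcases Sym2.eq_iff.1 h with ⟨rfl, rfl⟩ | ⟨rfl, rfl⟩
        · exact cross i _ _ (by simp) (by simp)
        · exact cross i _ _ (by simp) (by simp)
      · rcases Sym2.eq_iff.1 (hi h) with ⟨rfl, rfl⟩ | ⟨rfl, rfl⟩
        · exact cross i _ _ (by simp) (by simp)
        · exact cross i _ _ (by simp) (by simp)
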